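/- For every m ∈ ℕ₀, every λ ∈ ℂ∖ℤ and all z₁ ≤ z₂ in (−1,1), the bilinear expansion holds: the series 2π Σ_{ℓ ≥ m} L_{ℓm}(z₁) L_{ℓm}(z₂) / (ℓ(ℓ+1) − λ(λ+1)) converges and equals (1/2) Γ(1+λ−m) Γ(−λ−m) P^m_λ(−z₁) P^m_λ(z₂). -/

import Mathlib

open scoped BigOperators

/-- The Gauss hypergeometric function `₂F₁(a,b;c;x)` as a power series. -/
noncomputable def hyp2F1 (a b c x : ℂ) : ℂ :=
  ∑' n : ℕ, ((ascPochhammer ℂ n).eval a * (ascPochhammer ℂ n).eval b /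
    ((ascPochhammer ℂ n).eval c * (n.factorial : ℂ))) * x ^ n

/-- The associated Legendre function `P^m_λ` of general degree `λ` and order `m ∈ ℕ`. -/
noncomputable def PLeg (m : ℕ) (lam : ℂ) (z : ℝ) : ℂ :=
  ((ascPochhammer ℂ m).eval (-lam) * (ascPochhammer ℂ m).eval (1 + lam) / (m.factorial : ℂ)) *
    (((1 - z) / (1 + z) : ℂ)) ^ ((m : ℂ) / 2) *
    hyp2F1 (-lam) (lam + 1) (1 + (m : ℂ)) (((1 - z) / 2 : ℝ) : ℂ)

/-- Legendre polynomial via Rodrigues' formula. -/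
noncomputable def legendreP (l : ℕ) (x : ℝ) : ℝ :=
  (2 ^ l * (l.factorial : ℝ))⁻¹ * iteratedDeriv l (fun μ : ℝ => (μ ^ 2 - 1) ^ l) x

/-- Associated Legendre polynomial for nonnegative order `m`. -/
noncomputable def assocLegendreNat (l m : ℕ) (x : ℝ) : ℝ :=
  (-1 : ℝ) ^ m * (1 - x ^ 2) ^ ((m : ℝ) / 2) * iteratedDeriv m (legendreP l) x

/-- Normalized associated Legendre function `L_{ℓ m}` for `0 ≤ m ≤ ℓ`. -/
noncomputable def LnormNat (l m : ℕ) (z : ℝ) : ℝ :=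
  Real.sqrt ((2 * l + 1) / (4 * Real.pi) *
      (((l - m).factorial : ℝ) / ((l + m).factorial : ℝ))) *
    assocLegendreNat l m z

open Polynomial in
/-- The Legendre polynomial of degree `l`, as a polynomial. -/
noncomputable def legendrePoly (l : ℕ) : ℝ[X] :=
  C ((2 ^ l * (l.factorial : ℝ))⁻¹) * derivative^[l] ((X ^ 2 - 1) ^ l)

/-- The `m`-th derivative of the Legendre polynomial of degree `l`. -/
noncomputable def legendreDeriv (l m : ℕ) : Polynomial ℝ :=
  Polynomial.derivative^[m] (legendrePoly l)

/-- Integration of a real polynomial over `[-1, 1]`. -/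
noncomputable def polyIntegral : Polynomial ℝ →ₗ[ℝ] ℝ where
  toFun p := ∫ x in (-1 : ℝ)..1, p.eval x
  map_add' p q := by
    simp only [Polynomial.eval_add]
    exact intervalIntegral.integral_add (p.continuous.intervalIntegrable _ _)
      (q.continuous.intervalIntegrable _ _)
  map_smul' c p := by simp

section LegendrePolynomials

open Polynomial

theorem iteratedDeriv_eval_polynomial (p : ℝ[X]) (k : ℕ) :
    iteratedDeriv k (fun x => p.eval x) = fun x => (derivative^[k] p).eval x := by
  induction k with
  | zero => simp
  | succ k ih =>
    rw [iteratedDeriv_succ, ih, Function.iterate_succ_apply']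
    ext x
    exact Polynomial.deriv _

theorem legendreP_eq_eval (l : ℕ) : legendreP l = fun x => (legendrePoly l).eval x := by
  ext x
  have h := congrFun (iteratedDeriv_eval_polynomial ((X ^ 2 - 1) ^ l) l) x
  simp only [eval_pow, eval_sub, eval_X, eval_one] at h
  simp [legendreP, legendrePoly, h]

theorem iteratedDeriv_legendreP (l m : ℕ) (x : ℝ) :
    iteratedDeriv m (legendreP l) x = (legendreDeriv l m).eval x := by
  rw [legendreP_eq_eval, iteratedDeriv_eval_polynomial, legendreDeriv]

theorem derivative_legendreDeriv (l m : ℕ) :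
    derivative (legendreDeriv l m) = legendreDeriv l (m + 1) := by
  rw [legendreDeriv, legendreDeriv, Function.iterate_succ_apply']

theorem natDegree_iterate_derivative_eq_sub (p : ℝ[X]) (k : ℕ) :
    (derivative^[k] p).natDegree = p.natDegree - k := by
  induction k with
  | zero => simp
  | succ k ih => rw [Function.iterate_succ_apply', natDegree_derivative, ih, Nat.sub_sub]

theorem natDegree_legendrePoly (l : ℕ) : (legendrePoly l).natDegree = l := by
  have h0 : ((X ^ 2 - 1 : ℝ[X]) ^ l).natDegree = 2 * l := by
    rw [natDegree_pow, show (X ^ 2 - 1 : ℝ[X]) = X ^ 2 - C 1 by simp, natDegree_X_pow_sub_C,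
      mul_comm]
  rw [legendrePoly, natDegree_C_mul (by positivity), natDegree_iterate_derivative_eq_sub, h0]
  omega

theorem legendrePoly_ne_zero (l : ℕ) : legendrePoly l ≠ 0 := by
  rcases Nat.eq_zero_or_pos l with rfl | h
  · simp [legendrePoly]
  · intro h0
    have := natDegree_legendrePoly l
    rw [h0, natDegree_zero] at this
    omega

theorem degree_legendreDeriv (k m : ℕ) : (legendreDeriv (m + k) m).degree = k := by
  have h1 : (legendreDeriv (m + k) m).natDegree = k := by
    rw [legendreDeriv, natDegree_iterate_derivative_eq_sub, natDegree_legendrePoly]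
    omega
  have h2 : legendreDeriv (m + k) m ≠ 0 := by
    intro h0
    have h3 := coeff_iterate_derivative (k := m) (legendrePoly (m + k)) k
    rw [← legendreDeriv, h0, coeff_zero, add_comm k m] at h3
    have h4 : (legendrePoly (m + k)).coeff (m + k) ≠ 0 := by
      conv_lhs => rw [← natDegree_legendrePoly (m + k)]
      rw [natDegree_legendrePoly]
      have := leadingCoeff_ne_zero.mpr (legendrePoly_ne_zero (m + k))
      rwa [leadingCoeff, natDegree_legendrePoly] at this
    have h5 : (m + k).descFactorial m ≠ 0 := by
      rw [Ne, Nat.descFactorial_eq_zero_iff_lt]; omega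
    exact (smul_ne_zero h5 h4) h3.symm
  rw [degree_eq_natDegree h2, h1]

theorem iterate_derivative_ode (l j : ℕ) :
    (X ^ 2 - 1) * derivative^[j + 2] ((X ^ 2 - 1 : ℝ[X]) ^ l)
      + C (2 - 2 * l + 2 * j : ℝ) * X * derivative^[j + 1] ((X ^ 2 - 1 : ℝ[X]) ^ l)
      + C ((j - 2 * l) * (j + 1) : ℝ) * derivative^[j] ((X ^ 2 - 1 : ℝ[X]) ^ l) = 0 := by
  induction j with
  | zero =>
    rcases l with _ | l
    · simp
    rcases l with _ | l
    · simp
      ring_nf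
      rw [show (C 2 : ℝ[X]) = 2 from map_ofNat C 2]
      ring
    · simp [derivative_pow]
      ring_nf
  | succ j ih =>
    have := congrArg derivative ih
    simp only [derivative_add, derivative_mul, derivative_sub, derivative_X_pow, derivative_one,
      derivative_C, derivative_X, derivative_zero, ← Function.iterate_succ_apply'] at this
    rw [← this]
    simp only [map_add, map_sub, map_mul, map_ofNat, map_natCast, Nat.cast_add, Nat.cast_one,
      map_one, Function.iterate_succ_apply']
    ring

theorem legendreDeriv_ode (l m : ℕ) :
    (1 - X ^ 2) * legendreDeriv l (m + 2) - C (2 * (m + 1) : ℝ) * X * legendreDeriv l (m + 1)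
      + C (l * (l + 1) - m * (m + 1) : ℝ) * legendreDeriv l m = 0 := by
  have h := iterate_derivative_ode l (m + l)
  have h2 (k : ℕ) : legendreDeriv l k = C ((2 ^ l * (l.factorial : ℝ))⁻¹) *
      derivative^[k + l] ((X ^ 2 - 1) ^ l) := by
    rw [legendreDeriv, legendrePoly, iterate_derivative_C_mul, ← Function.iterate_add_apply]
  rw [h2, h2, h2, show m + 2 + l = m + l + 2 by ring, show m + 1 + l = m + l + 1 by ring]
  have h3 := congrArg (fun p => -C ((2 ^ l * (l.factorial : ℝ))⁻¹) * p) h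
  simp only [mul_zero] at h3
  rw [← h3]
  simp only [map_add, map_sub, map_mul, map_ofNat, map_natCast, Nat.cast_add, map_one]
  ring

theorem derivative_weight_mul_legendreDeriv (l m : ℕ) :
    derivative ((1 - X ^ 2) ^ (m + 1) * legendreDeriv l (m + 1)) =
      -(C (l * (l + 1) - m * (m + 1) : ℝ) * ((1 - X ^ 2) ^ m * legendreDeriv l m)) := by
  have h := legendreDeriv_ode l m
  have h1 : derivative ((1 - X ^ 2 : ℝ[X]) ^ (m + 1))
      = -(C (2 * (m + 1) : ℝ) * X * (1 - X ^ 2) ^ m) := by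
    simp only [derivative_pow_succ, derivative_sub, derivative_one, map_mul,
      map_ofNat, map_add, map_one, map_natCast]
    simp
    ring
  rw [derivative_mul, h1, derivative_legendreDeriv]
  linear_combination (1 - X ^ 2 : ℝ[X]) ^ m * h

theorem polyIntegral_apply (p : ℝ[X]) : polyIntegral p = ∫ x in (-1 : ℝ)..1, p.eval x := rfl

theorem polyIntegral_derivative (p : ℝ[X]) :
    polyIntegral (derivative p) = p.eval 1 - p.eval (-1) := by
  rw [polyIntegral_apply]
  exact intervalIntegral.integral_eq_sub_of_hasDerivAt (fun x _ => p.hasDerivAt x)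
    ((derivative p).continuous.intervalIntegrable _ _)

theorem polyIntegral_C_mul (c : ℝ) (p : ℝ[X]) : polyIntegral (C c * p) = c * polyIntegral p := by
  rw [← smul_eq_C_mul, map_smul, smul_eq_mul]

theorem legendreDeriv_eigenvalue_ne {m k j : ℕ} (h : k ≠ j) :
    (((m + k : ℕ) : ℝ) * ((m + k : ℕ) + 1) - ((m + j : ℕ) : ℝ) * ((m + j : ℕ) + 1)) ≠ 0 := by
  have h1 : (k : ℝ) ≠ j := by exact_mod_cast h
  push_cast
  have : ((m + k : ℝ) * (m + k + 1) - (m + j) * (m + j + 1)) = (k - j) * (2 * m + k + j + 1) := by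
    ring
  rw [this]
  exact mul_ne_zero (sub_ne_zero.mpr h1) (by positivity)

theorem polyIntegral_legendreDeriv_orthogonal (m : ℕ) {k j : ℕ} (h : k ≠ j) :
    polyIntegral ((1 - X ^ 2) ^ m * legendreDeriv (m + k) m * legendreDeriv (m + j) m) = 0 := by
  have hk := derivative_weight_mul_legendreDeriv (m + k) m
  have hj := derivative_weight_mul_legendreDeriv (m + j) m
  have h1 : derivative ((1 - X ^ 2) ^ (m + 1) * legendreDeriv (m + j) (m + 1) *
        legendreDeriv (m + k) m
      - (1 - X ^ 2) ^ (m + 1) * legendreDeriv (m + k) (m + 1) * legendreDeriv (m + j) m) =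
      C (((m + k : ℕ) : ℝ) * ((m + k : ℕ) + 1) - ((m + j : ℕ) : ℝ) * ((m + j : ℕ) + 1)) *
      ((1 - X ^ 2) ^ m * legendreDeriv (m + k) m * legendreDeriv (m + j) m) := by
    rw [derivative_sub, derivative_mul (g := legendreDeriv (m + k) m),
      derivative_mul (g := legendreDeriv (m + j) m), hk, hj, derivative_legendreDeriv,
      derivative_legendreDeriv]
    simp only [map_sub]
    ring
  have h2 := polyIntegral_derivative ((1 - X ^ 2) ^ (m + 1) * legendreDeriv (m + j) (m + 1) *
        legendreDeriv (m + k) m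
      - (1 - X ^ 2) ^ (m + 1) * legendreDeriv (m + k) (m + 1) * legendreDeriv (m + j) m)
  rw [h1, polyIntegral_C_mul] at h2
  refine (mul_eq_zero.mp (h2.trans ?_)).resolve_left (legendreDeriv_eigenvalue_ne h)
  simp

theorem polyIntegral_legendreDeriv_sq_succ (l m : ℕ) :
    polyIntegral ((1 - X ^ 2) ^ (m + 1) * legendreDeriv l (m + 1) * legendreDeriv l (m + 1)) =
      (l * (l + 1) - m * (m + 1)) *
        polyIntegral ((1 - X ^ 2) ^ m * legendreDeriv l m * legendreDeriv l m) := by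
  have h2 := polyIntegral_derivative
    ((1 - X ^ 2) ^ (m + 1) * legendreDeriv l (m + 1) * legendreDeriv l m)
  rw [derivative_mul, derivative_weight_mul_legendreDeriv, derivative_legendreDeriv, map_add,
    neg_mul, map_neg, mul_assoc (C _), polyIntegral_C_mul] at h2
  simp at h2
  linarith

/-- The Legendre polynomials' derivatives of fixed order, as a sequence of polynomials. -/
noncomputable def legendreSequence (m : ℕ) : Polynomial.Sequence ℝ where
  elems' k := legendreDeriv (m + k) m
  degree_eq' k := degree_legendreDeriv k m

theorem mem_span_legendreDeriv (m n : ℕ) {p : ℝ[X]} (hp : p.degree < n) :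
    p ∈ Submodule.span ℝ ((fun k => legendreDeriv (m + k) m) '' Set.Iio n) := by
  have h := (legendreSequence m).span_degreeLT (m := n)
    (fun i _ => isUnit_iff_ne_zero.mpr (leadingCoeff_ne_zero.mpr ((legendreSequence m).ne_zero i)))
  have h2 : p ∈ degreeLT ℝ n := mem_degreeLT.mpr hp
  rw [← h] at h2
  exact h2

theorem polyIntegral_mul_legendreDeriv_of_degree_lt (m k : ℕ) {p : ℝ[X]} (hp : p.degree < k) :
    polyIntegral ((1 - X ^ 2) ^ m * legendreDeriv (m + k) m * p) = 0 := by
  have h := mem_span_legendreDeriv m k hp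
  clear hp
  induction h using Submodule.span_induction with
  | mem x hx =>
    obtain ⟨j, hj, rfl⟩ := hx
    exact polyIntegral_legendreDeriv_orthogonal m (Set.mem_Iio.mp hj).ne'
  | zero => simp
  | add x y _ _ hx hy => rw [mul_add, map_add, hx, hy, add_zero]
  | smul a x _ hx => rw [mul_smul_comm, map_smul, hx, smul_zero]

theorem legendrePoly_eval_one (l : ℕ) : (legendrePoly l).eval 1 = 1 := by
  have h := aeval_iterate_derivative_self (A := ℝ) ((X ^ 2 - 1 : ℝ[X]) ^ l) l 1
    (p' := (X + 1) ^ l) (by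
      rw [← mul_pow]; simp; ring)
  rw [coe_aeval_eq_eval] at h
  rw [legendrePoly, eval_mul, h]
  simp
  have : (l.factorial : ℝ) ≠ 0 := by positivity
  field_simp
  norm_num

theorem legendrePoly_eval_neg_one (l : ℕ) : (legendrePoly l).eval (-1) = (-1) ^ l := by
  have h := aeval_iterate_derivative_self (A := ℝ) ((X ^ 2 - 1 : ℝ[X]) ^ l) l (-1)
    (p' := (X - 1) ^ l) (by
      rw [← mul_pow]; simp; ring)
  rw [coe_aeval_eq_eval] at h
  rw [legendrePoly, eval_mul, h]
  have : (l.factorial : ℝ) ≠ 0 := by positivity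
  simp
  rw [show (-1 - 1 : ℝ) = (-1) * 2 by norm_num, mul_pow]
  field_simp

theorem polyIntegral_legendrePoly_sq (l : ℕ) :
    polyIntegral (legendrePoly l * legendrePoly l) = 2 / (2 * l + 1) := by
  have hdeg : (X * derivative (legendrePoly l) - C (l : ℝ) * legendrePoly l).degree < (l : WithBot ℕ) := by
    rw [degree_lt_iff_coeff_zero]
    intro n hn
    have hc : (X * derivative (legendrePoly l)).coeff n = n * (legendrePoly l).coeff n := by
      rcases n with _ | n
      · simp
      · rw [coeff_X_mul, coeff_derivative]
        push_cast
        ring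
    rw [coeff_sub, coeff_C_mul, hc]
    rcases hn.eq_or_lt with rfl | h
    · ring
    · rw [coeff_eq_zero_of_natDegree_lt (by rwa [natDegree_legendrePoly])]
      ring
  have h1 := polyIntegral_mul_legendreDeriv_of_degree_lt 0 l hdeg
  have h2 := polyIntegral_derivative (X * legendrePoly l * legendrePoly l)
  rw [eval_mul, eval_mul, eval_mul, eval_mul, legendrePoly_eval_one, legendrePoly_eval_neg_one,
    eval_X, eval_X] at h2
  have h3 : ((-1 : ℝ) ^ l) * (-1) ^ l = 1 := by rw [← mul_pow]; norm_num
  have h4 : derivative (X * legendrePoly l * legendrePoly l) =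
      C 2 * ((1 - X ^ 2) ^ 0 * legendreDeriv (0 + l) 0 *
        (X * derivative (legendrePoly l) - C (l : ℝ) * legendrePoly l)) +
      C (2 * l + 1 : ℝ) * (legendrePoly l * legendrePoly l) := by
    rw [derivative_mul, derivative_mul, zero_add, legendreDeriv]
    simp
    rw [show (C 2 : ℝ[X]) = 2 from map_ofNat C 2]
    ring
  rw [h4, map_add, polyIntegral_C_mul, polyIntegral_C_mul, h1] at h2
  rw [eq_div_iff (by positivity)]
  linear_combination h2 + h3

/-- The squared norm of `legendreDeriv l m` for the weight `(1 - x²)ᵐ`. -/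
theorem polyIntegral_legendreDeriv_sq (k m : ℕ) :
    polyIntegral ((1 - X ^ 2) ^ m * legendreDeriv (m + k) m * legendreDeriv (m + k) m) =
      2 / (2 * ((m + k : ℕ) : ℝ) + 1) * (((2 * m + k).factorial : ℝ) / (k.factorial : ℝ)) := by
  induction m generalizing k with
  | zero =>
    have : (k.factorial : ℝ) ≠ 0 := by positivity
    simp [legendreDeriv, polyIntegral_legendrePoly_sq, this]
  | succ m ih =>
    have h := ih (k + 1)
    rw [show m + 1 + k = m + (k + 1) by ring, polyIntegral_legendreDeriv_sq_succ, h,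
      show 2 * (m + 1) + k = 2 * m + (k + 1) + 1 by ring, Nat.factorial_succ (2 * m + (k + 1)),
      Nat.factorial_succ k]
    have : (k.factorial : ℝ) ≠ 0 := by positivity
    push_cast
    field_simp
    ring

theorem eval_zero_le_of_derivative_eq_X_mul {p r : ℝ[X]} (h : derivative p = X * r)
    (hr : ∀ x ∈ Set.Icc (-1 : ℝ) 1, 0 ≤ r.eval x) {t : ℝ} (ht : t ∈ Set.Icc (-1 : ℝ) 1) :
    p.eval 0 ≤ p.eval t := by
  have hd (x : ℝ) : deriv (fun y => p.eval y) x = x * r.eval x := by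
    rw [Polynomial.deriv, h, eval_mul, eval_X]
  rcases le_total 0 t with h0 | h0
  · refine monotoneOn_of_deriv_nonneg (convex_Icc (0 : ℝ) 1) p.continuous.continuousOn
      p.differentiable.differentiableOn ?_ (by simp) ⟨h0, ht.2⟩ h0
    intro x hx
    rw [interior_Icc] at hx
    rw [hd]
    exact mul_nonneg hx.1.le (hr x ⟨by linarith [hx.1], hx.2.le⟩)
  · refine antitoneOn_of_deriv_nonpos (convex_Icc (-1 : ℝ) 0) p.continuous.continuousOn
      p.differentiable.differentiableOn ?_ ⟨ht.1, h0⟩ (by simp) h0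
    intro x hx
    rw [interior_Icc] at hx
    rw [hd]
    exact mul_nonpos_of_nonpos_of_nonneg hx.2.le (hr x ⟨hx.1.le, by linarith [hx.2]⟩)

theorem one_sub_sq_nonneg {x : ℝ} (hx : x ∈ Set.Icc (-1 : ℝ) 1) : 0 ≤ 1 - x ^ 2 := by
  nlinarith [hx.1, hx.2]

theorem polyIntegral_mono {p q : ℝ[X]} (h : ∀ x ∈ Set.Icc (-1 : ℝ) 1, p.eval x ≤ q.eval x) :
    polyIntegral p ≤ polyIntegral q :=
  intervalIntegral.integral_mono_on (by norm_num) (p.continuous.intervalIntegrable _ _)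
    (q.continuous.intervalIntegrable _ _) h

theorem polyIntegral_weight_pos (m : ℕ) : 0 < polyIntegral ((1 - X ^ 2) ^ m) := by
  rw [polyIntegral_apply]
  refine intervalIntegral.intervalIntegral_pos_of_pos_on
    ((Polynomial.continuous _).intervalIntegrable _ _) ?_ (by norm_num)
  intro x hx
  have : 0 < 1 - x ^ 2 := by nlinarith [hx.1, hx.2]
  simpa using pow_pos this m

theorem polyIntegral_legendreDeriv_sq_pos (k m : ℕ) :
    0 < polyIntegral ((1 - X ^ 2) ^ m * legendreDeriv (m + k) m * legendreDeriv (m + k) m) := by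
  rw [polyIntegral_legendreDeriv_sq]
  positivity

theorem legendreDeriv_eigenvalue_nonneg (m k : ℕ) :
    0 ≤ ((m + k : ℕ) : ℝ) * ((m + k : ℕ) + 1) - m * (m + 1) := by
  push_cast
  have : ((m : ℝ) + k) * (m + k + 1) - m * (m + 1) = k * (2 * m + k + 1) := by ring
  rw [this]
  positivity

/-- A pointwise bound for the derivatives of Legendre polynomials in terms of their weighted
`L²` norm, obtained from Sonin's monotone functions. -/
theorem legendreDeriv_sq_le (m k : ℕ) {z : ℝ} (hz : z ∈ Set.Icc (-1 : ℝ) 1) :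
    polyIntegral ((1 - X ^ 2) ^ m) *
        ((1 - z ^ 2) ^ (2 * m + 1) * (legendreDeriv (m + k) m).eval z ^ 2) ≤
      2 * polyIntegral ((1 - X ^ 2) ^ m * legendreDeriv (m + k) m * legendreDeriv (m + k) m) := by
  set κ : ℝ := ((m + k : ℕ) : ℝ) * ((m + k : ℕ) + 1) - m * (m + 1) with hκ
  set y := legendreDeriv (m + k) m with hy
  set y' := legendreDeriv (m + k) (m + 1) with hy'
  set N := polyIntegral ((1 - X ^ 2) ^ m * y * y) with hN
  have hN0 : 0 < N := polyIntegral_legendreDeriv_sq_pos k m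
  have hκ0 : 0 ≤ κ := legendreDeriv_eigenvalue_nonneg m k
  have hc : C κ⁻¹ * C κ * y' = y' := by
    rcases Nat.eq_zero_or_pos k with rfl | hk
    · have : y' = 0 := by
        rw [hy', ← derivative_legendreDeriv, ← Polynomial.degree_eq_bot]
        rw [eq_C_of_degree_eq_zero (degree_legendreDeriv 0 m)]
        simp
      rw [this, mul_zero]
    · have hk' : (0 : ℝ) < k := by exact_mod_cast hk
      have : κ ≠ 0 := by
        have : κ = k * (2 * m + k + 1) := by rw [hκ]; push_cast; ring
        rw [this]
        positivity
      rw [← C_mul, inv_mul_cancel₀ this, C_1, one_mul]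
  have hcκ : κ⁻¹ * κ ≤ 1 := by
    rcases eq_or_ne κ 0 with h | h
    · rw [h]; simp
    · rw [inv_mul_cancel₀ h]
  have hode := legendreDeriv_ode (m + k) m
  rw [← hκ, ← hy, ← hy'] at hode
  have hdy : derivative y = y' := derivative_legendreDeriv _ _
  have hdy' : derivative y' = legendreDeriv (m + k) (m + 2) := derivative_legendreDeriv _ _
  set S : ℝ[X] := y ^ 2 + C κ⁻¹ * ((1 - X ^ 2) * y' ^ 2) with hS
  have hdS : derivative S = X * (C (2 * (2 * m + 1) * κ⁻¹ : ℝ) * y' ^ 2) := by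
    rw [hS]
    simp only [derivative_add, derivative_mul, derivative_C, derivative_pow, derivative_sub,
      derivative_one, derivative_X, hdy, hdy']
    simp only [map_add, map_mul, map_ofNat, map_natCast, map_one, Nat.cast_ofNat] at hode ⊢
    linear_combination (2 * C κ⁻¹ * y') * hode - 2 * y * hc
  have hdT : derivative (-((1 - X ^ 2 : ℝ[X]) ^ (2 * m + 1) * S)) =
      X * (C (2 * (2 * m + 1) : ℝ) * ((1 - X ^ 2) ^ (2 * m) * y ^ 2)) := by
    rw [derivative_neg, derivative_mul, hdS, hS, derivative_pow_succ]
    simp only [derivative_sub, derivative_one, derivative_X_pow]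
    simp only [map_add, map_mul, map_ofNat, map_natCast, map_one, Nat.cast_mul, Nat.cast_ofNat,
      pow_succ]
    ring
  have hT0 : (1 - z ^ 2) ^ (2 * m + 1) * S.eval z ≤ S.eval 0 := by
    have := eval_zero_le_of_derivative_eq_X_mul hdT (fun x hx => by
      have := one_sub_sq_nonneg hx
      simp
      positivity) hz
    simp only [eval_neg, eval_mul, eval_pow, eval_sub, eval_one, eval_X] at this
    norm_num at this
    exact this
  have hS0 (t : ℝ) (ht : t ∈ Set.Icc (-1 : ℝ) 1) : S.eval 0 ≤ S.eval t :=
    eval_zero_le_of_derivative_eq_X_mul hdS (fun x hx => by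
      simp
      positivity) ht
  have hle : polyIntegral (C (S.eval 0) * (1 - X ^ 2) ^ m) ≤ polyIntegral ((1 - X ^ 2) ^ m * S) := by
    refine polyIntegral_mono fun x hx => ?_
    have := one_sub_sq_nonneg hx
    simp only [eval_mul, eval_pow, eval_sub, eval_one, eval_X, eval_C]
    rw [mul_comm]
    exact mul_le_mul_of_nonneg_left (hS0 x hx) (by positivity)
  have hint : polyIntegral ((1 - X ^ 2) ^ m * S) = N + κ⁻¹ * (κ * N) := by
    have h1 : (1 - X ^ 2) ^ m * S = (1 - X ^ 2) ^ m * y * y +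
        C κ⁻¹ * ((1 - X ^ 2) ^ (m + 1) * y' * y') := by rw [hS]; ring
    rw [h1, map_add, polyIntegral_C_mul, hy', polyIntegral_legendreDeriv_sq_succ]
  have hyS : y.eval z ^ 2 ≤ S.eval z := by
    have := one_sub_sq_nonneg hz
    rw [hS]
    simp
    positivity
  have hw := polyIntegral_weight_pos m
  have hz0 := one_sub_sq_nonneg hz
  rw [polyIntegral_C_mul, hint] at hle
  calc _ ≤ polyIntegral ((1 - X ^ 2) ^ m) * ((1 - z ^ 2) ^ (2 * m + 1) * S.eval z) := by gcongr
    _ ≤ polyIntegral ((1 - X ^ 2) ^ m) * S.eval 0 := by gcongr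
    _ ≤ N + (κ⁻¹ * κ) * N := by rw [mul_comm]; linarith
    _ ≤ N + 1 * N := by gcongr
    _ = 2 * N := by ring

end LegendrePolynomials

section LegendreFunctions

open Filter Topology

/-- The numerator coefficients `(-λ)ₙ (1+λ)ₙ / n!` of the hypergeometric series of Legendre type. -/
noncomputable def legendreCoeff (lam : ℂ) (n : ℕ) : ℂ :=
  (ascPochhammer ℂ n).eval (-lam) * (ascPochhammer ℂ n).eval (1 + lam) / (n.factorial : ℂ)

/-- The hypergeometric function `₂F₁(-λ, λ+1; 1+m; x)` divided by `m!`. -/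
noncomputable def scaledHyp (lam : ℂ) (m : ℕ) (x : ℂ) : ℂ :=
  ∑' n : ℕ, legendreCoeff lam n / ((m + n).factorial : ℂ) * x ^ n

/-- The product `(-λ)ₘ (1+λ)ₘ`. -/
noncomputable def pochProd (lam : ℂ) (m : ℕ) : ℂ :=
  (ascPochhammer ℂ m).eval (-lam) * (ascPochhammer ℂ m).eval (1 + lam)

/-- The `m`-th derivative of `₂F₁(-λ, λ+1; 1; x)`, written in Euler-transformed form. -/
noncomputable def hypDeriv (lam : ℂ) (m : ℕ) (x : ℂ) : ℂ :=
  pochProd lam m * ((1 - x) ^ m)⁻¹ * scaledHyp lam m x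

theorem pochProd_succ (lam : ℂ) (m : ℕ) :
    pochProd lam (m + 1) = pochProd lam m * ((m - lam) * (m + 1 + lam)) := by
  rw [pochProd, pochProd, ascPochhammer_succ_eval, ascPochhammer_succ_eval]
  ring

theorem pochProd_ne_zero {lam : ℂ} (hlam : ∀ n : ℤ, lam ≠ (n : ℂ)) (m : ℕ) :
    pochProd lam m ≠ 0 := by
  induction m with
  | zero => simp [pochProd]
  | succ m ih =>
    rw [pochProd_succ]
    refine mul_ne_zero ih (mul_ne_zero ?_ ?_)
    · intro h
      exact hlam m (by push_cast; linear_combination -h)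
    · intro h
      exact hlam (-(m + 1)) (by push_cast; linear_combination h)

theorem legendreCoeff_eq (lam : ℂ) (n : ℕ) :
    legendreCoeff lam n = pochProd lam n / (n.factorial : ℂ) := rfl

theorem legendreCoeff_ne_zero {lam : ℂ} (hlam : ∀ n : ℤ, lam ≠ (n : ℂ)) (n : ℕ) :
    legendreCoeff lam n ≠ 0 :=
  div_ne_zero (pochProd_ne_zero hlam n) (by exact_mod_cast n.factorial_ne_zero)

theorem succ_mul_legendreCoeff_succ (lam : ℂ) (n : ℕ) :
    (n + 1) * legendreCoeff lam (n + 1) = (n - lam) * (n + 1 + lam) * legendreCoeff lam n := by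
  rw [legendreCoeff_eq, legendreCoeff_eq, pochProd_succ, Nat.factorial_succ]
  have h1 : (n.factorial : ℂ) ≠ 0 := by exact_mod_cast n.factorial_ne_zero
  have h2 : (n + 1 : ℂ) ≠ 0 := by exact_mod_cast n.succ_ne_zero
  push_cast
  field_simp

theorem tendsto_natCast_add_div_natCast_add (a b : ℂ) :
    Tendsto (fun n : ℕ => ((n : ℂ) + a) / (n + b)) atTop (𝓝 1) := by
  have h1 := tendsto_natCast_div_add_atTop (𝕜 := ℂ) a
  have h2 := tendsto_natCast_div_add_atTop (𝕜 := ℂ) b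
  have h3 := h2.div h1 one_ne_zero
  rw [div_one] at h3
  refine h3.congr' ?_
  filter_upwards [eventually_ne_atTop 0] with n hn
  have : (n : ℂ) ≠ 0 := by exact_mod_cast hn
  simp only [Pi.div_apply]
  rw [div_div_div_eq, mul_comm, mul_div_mul_right _ _ this]

theorem summable_norm_mul_pow_of_ratio {b : ℕ → ℂ} (hb : ∀ n, b n ≠ 0)
    (h : Tendsto (fun n => b (n + 1) / b n) atTop (𝓝 1)) {r : ℝ} (h0 : 0 ≤ r) (h1 : r < 1) :
    Summable (fun n => ‖b n‖ * r ^ n) := by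
  obtain ⟨s, hs, hs1⟩ := exists_between h1
  have hs0 : 0 < s := h0.trans_lt hs
  have hsum : Summable (fun n => ‖b n‖ * s ^ n) := by
    refine summable_of_ratio_test_tendsto_lt_one hs1
      (Eventually.of_forall fun n => mul_ne_zero (norm_ne_zero_iff.mpr (hb n)) (by positivity)) ?_
    have h2 := (h.norm).mul_const s
    simp only [norm_one, one_mul] at h2
    refine h2.congr fun n => ?_
    have : ‖b n‖ ≠ 0 := norm_ne_zero_iff.mpr (hb n)
    simp only [norm_mul, norm_div, norm_norm, norm_pow, Real.norm_of_nonneg hs0.le]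
    field_simp
    ring
  refine Summable.of_nonneg_of_le (fun n => by positivity) (fun n => ?_) hsum
  gcongr

theorem tendsto_ratio_succ_mul {b : ℕ → ℂ}
    (h : Tendsto (fun n => b (n + 1) / b n) atTop (𝓝 1)) :
    Tendsto (fun n : ℕ => (((n + 1 : ℕ) : ℂ) + 1) * b (n + 1 + 1) / (((n : ℂ) + 1) * b (n + 1)))
      atTop (𝓝 1) := by
  have h2 := (tendsto_natCast_add_div_natCast_add 2 1).mul (h.comp (tendsto_add_atTop_nat 1))
  rw [one_mul] at h2
  refine h2.congr fun n => ?_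
  simp only [Function.comp]
  rw [div_mul_div_comm]
  congr 2
  push_cast
  ring

theorem summable_succ_mul_pow_of_ratio {b : ℕ → ℂ} (hb : ∀ n, b n ≠ 0)
    (h : Tendsto (fun n => b (n + 1) / b n) atTop (𝓝 1)) {x : ℂ} (hx : ‖x‖ < 1) :
    Summable (fun n : ℕ => ((n : ℂ) + 1) * b (n + 1) * x ^ n) := by
  refine Summable.of_norm ?_
  simpa only [norm_mul, norm_pow] using summable_norm_mul_pow_of_ratio
    (b := fun n : ℕ => ((n : ℂ) + 1) * b (n + 1))
    (fun n => mul_ne_zero (by exact_mod_cast n.succ_ne_zero) (hb _)) (tendsto_ratio_succ_mul h)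
    (norm_nonneg x) hx

theorem hasDerivAt_tsum_pow_of_ratio {b : ℕ → ℂ} (hb : ∀ n, b n ≠ 0)
    (h : Tendsto (fun n => b (n + 1) / b n) atTop (𝓝 1)) {x : ℂ} (hx : ‖x‖ < 1) :
    HasDerivAt (fun z => ∑' n, b n * z ^ n) (∑' n : ℕ, ((n : ℂ) + 1) * b (n + 1) * x ^ n) x := by
  obtain ⟨r, hr, hr1⟩ := exists_between hx
  have hr0 : 0 < r := (norm_nonneg x).trans_lt hr
  have hs := summable_norm_mul_pow_of_ratio (b := fun n : ℕ => ((n : ℂ) + 1) * b (n + 1))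
    (fun n => mul_ne_zero (by exact_mod_cast n.succ_ne_zero) (hb _)) (tendsto_ratio_succ_mul h)
    hr0.le hr1
  have hu : Summable (fun n : ℕ => ‖(n : ℂ) * b n‖ * r ^ (n - 1)) := by
    rw [← summable_nat_add_iff 1]
    simpa using hs
  have hd := hasDerivAt_tsum_of_isPreconnected (g := fun n z => b n * z ^ n)
    (g' := fun n z => (n : ℂ) * b n * z ^ (n - 1)) (y₀ := 0) (y := x) (t := Metric.ball 0 r)
    hu Metric.isOpen_ball (convex_ball (0 : ℂ) r).isPreconnected
    (fun n y _ => by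
      refine ((hasDerivAt_pow n y).const_mul (b n)).congr_deriv ?_
      ring)
    (fun n y hy => by
      rw [norm_mul, norm_pow]
      have : ‖y‖ ≤ r := (mem_ball_zero_iff.mp hy).le
      gcongr)
    (Metric.mem_ball_self hr0)
    (summable_of_ne_finset_zero (s := {0}) fun n hn => by
      have : n ≠ 0 := by simpa using hn
      simp [this])
    (mem_ball_zero_iff.mpr hr)
  refine hd.congr_deriv ?_
  have hsum : Summable (fun n : ℕ => (n : ℂ) * b n * x ^ (n - 1)) := by
    refine Summable.of_norm_bounded hu fun n => ?_
    rw [norm_mul, norm_pow]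
    gcongr
  rw [hsum.tsum_eq_zero_add]
  simp

theorem tendsto_ratio_scaledHyp {lam : ℂ} (hlam : ∀ n : ℤ, lam ≠ (n : ℂ)) (m : ℕ) :
    Tendsto (fun n => legendreCoeff lam (n + 1) / ((m + (n + 1)).factorial : ℂ) /
      (legendreCoeff lam n / ((m + n).factorial : ℂ))) atTop (𝓝 1) := by
  have h := (tendsto_natCast_add_div_natCast_add (-lam) 1).mul
    (tendsto_natCast_add_div_natCast_add (1 + lam) (m + 1))
  rw [one_mul] at h
  refine h.congr fun n => ?_
  have h1 : ((m + n).factorial : ℂ) ≠ 0 := by exact_mod_cast (m + n).factorial_ne_zero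
  have h2 : (n + 1 : ℂ) ≠ 0 := by exact_mod_cast n.succ_ne_zero
  have h3 : (n + (m + 1) : ℂ) ≠ 0 := by exact_mod_cast (n + m).succ_ne_zero
  have h4 := legendreCoeff_ne_zero hlam n
  have h5 : legendreCoeff lam (n + 1) =
      (n - lam) * (n + 1 + lam) * legendreCoeff lam n / (n + 1) := by
    rw [← succ_mul_legendreCoeff_succ]
    field_simp
  rw [h5, show m + (n + 1) = m + n + 1 by ring, Nat.factorial_succ]
  push_cast
  have h6 : (m + n + 1 : ℂ) ≠ 0 := by exact_mod_cast (m + n).succ_ne_zero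
  rw [show (n + (m + 1) : ℂ) = m + n + 1 by ring]
  field_simp
  ring

theorem scaledHyp_coeff_ne_zero {lam : ℂ} (hlam : ∀ n : ℤ, lam ≠ (n : ℂ)) (m n : ℕ) :
    legendreCoeff lam n / ((m + n).factorial : ℂ) ≠ 0 :=
  div_ne_zero (legendreCoeff_ne_zero hlam n) (by exact_mod_cast (m + n).factorial_ne_zero)

theorem hasSum_scaledHyp {lam : ℂ} (hlam : ∀ n : ℤ, lam ≠ (n : ℂ)) (m : ℕ) {x : ℂ}
    (hx : ‖x‖ < 1) :
    HasSum (fun n => legendreCoeff lam n / ((m + n).factorial : ℂ) * x ^ n)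
      (scaledHyp lam m x) := by
  refine Summable.hasSum (Summable.of_norm ?_)
  simpa only [norm_mul, norm_pow] using summable_norm_mul_pow_of_ratio
    (scaledHyp_coeff_ne_zero hlam m) (tendsto_ratio_scaledHyp hlam m) (norm_nonneg x) hx

theorem HasSum.of_forall_eq {f g : ℕ → ℂ} {a : ℂ} (hg : HasSum g a) (h : ∀ n, f n = g n) :
    HasSum f a := by
  rwa [funext h]

theorem hasSum_mul_pow_of_shift {p q : ℕ → ℂ} {x s : ℂ} (hs : HasSum (fun n => q n * x ^ n) s)
    (h0 : p 0 = 0) (h : ∀ n, p (n + 1) = q n) : HasSum (fun n => p n * x ^ n) (x * s) := by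
  rw [← hasSum_nat_add_iff' 1]
  simp only [Finset.range_one, Finset.sum_singleton, h0, zero_mul, sub_zero]
  have e : (fun n => p (n + 1) * x ^ (n + 1)) = fun n => x * (q n * x ^ n) := by
    funext n
    rw [h]
    ring
  rw [e]
  exact hs.mul_left x

theorem hasDerivAt_scaledHyp {lam : ℂ} (hlam : ∀ n : ℤ, lam ≠ (n : ℂ)) (m : ℕ) {x : ℂ}
    (hx : ‖x‖ < 1) : ∃ d, HasDerivAt (scaledHyp lam m) d x ∧
      (1 - x) * d + m * scaledHyp lam m x = (m - lam) * (m + 1 + lam) * scaledHyp lam (m + 1) x := by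
  have hs0 : Summable (fun n : ℕ => ((n : ℂ) + 1) *
      (legendreCoeff lam (n + 1) / ((m + (n + 1)).factorial : ℂ)) * x ^ n) := by
    exact summable_succ_mul_pow_of_ratio
      (b := fun n => legendreCoeff lam n / ((m + n).factorial : ℂ))
      (scaledHyp_coeff_ne_zero hlam m) (tendsto_ratio_scaledHyp hlam m) hx
  have hd := hasDerivAt_tsum_pow_of_ratio
    (b := fun n => legendreCoeff lam n / ((m + n).factorial : ℂ))
    (scaledHyp_coeff_ne_zero hlam m) (tendsto_ratio_scaledHyp hlam m) hx
  refine ⟨_, hd, ?_⟩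
  have hs := hs0.hasSum
  generalize (∑' n : ℕ, ((n : ℂ) + 1) *
      (legendreCoeff lam (n + 1) / ((m + (n + 1)).factorial : ℂ)) * x ^ n) = d at hs ⊢
  have hs' := hasSum_mul_pow_of_shift (p := fun n : ℕ => (n : ℂ) *
    (legendreCoeff lam n / ((m + n).factorial : ℂ))) hs (by simp) (fun n => by push_cast; rfl)
  have h1 := (hs.sub hs').add ((hasSum_scaledHyp hlam m hx).mul_left (m : ℂ))
  have h2 := (hasSum_scaledHyp hlam (m + 1) hx).mul_left ((m - lam) * (m + 1 + lam))
  rw [sub_mul, one_mul]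
  refine h1.unique ?_
  refine h2.of_forall_eq fun n => ?_
  have h3 := succ_mul_legendreCoeff_succ lam n
  have h4 : ((m + n).factorial : ℂ) ≠ 0 := by exact_mod_cast (m + n).factorial_ne_zero
  have h6 : (m + n + 1 : ℂ) ≠ 0 := by exact_mod_cast (m + n).succ_ne_zero
  rw [← mul_div_assoc ((n : ℂ) + 1), h3, show m + (n + 1) = m + n + 1 by ring,
    show m + 1 + n = m + n + 1 by ring, Nat.factorial_succ]
  push_cast
  field_simp
  ring

theorem scaledHyp_contiguous {lam : ℂ} (hlam : ∀ n : ℤ, lam ≠ (n : ℂ)) (m : ℕ) {x : ℂ}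
    (hx : ‖x‖ < 1) :
    x * ((lam * (lam + 1) - (m + 1) * (m + 2)) * scaledHyp lam (m + 2) x)
      - (m + 1) * (1 - 2 * x) * scaledHyp lam (m + 1) x + (1 - x) * scaledHyp lam m x = 0 := by
  have h0 := hasSum_scaledHyp hlam m hx
  have h1 := hasSum_scaledHyp hlam (m + 1) hx
  have h2 := hasSum_scaledHyp hlam (m + 2) hx
  have hp := h0.sub (h1.mul_left ((m : ℂ) + 1))
  have hq := (h0.sub (h1.mul_left (2 * ((m : ℂ) + 1)))).sub
    (h2.mul_left (lam * (lam + 1) - (m + 1) * (m + 2)))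
  have hq' := hasSum_mul_pow_of_shift (x := x)
    (p := fun n => legendreCoeff lam n / ((m + n).factorial : ℂ)
      - ((m : ℂ) + 1) * (legendreCoeff lam n / ((m + 1 + n).factorial : ℂ)))
    (q := fun n => legendreCoeff lam n / ((m + n).factorial : ℂ)
      - 2 * ((m : ℂ) + 1) * (legendreCoeff lam n / ((m + 1 + n).factorial : ℂ))
      - (lam * (lam + 1) - (m + 1) * (m + 2)) *
        (legendreCoeff lam n / ((m + 2 + n).factorial : ℂ)))
    (hq.of_forall_eq fun n => by ring) ?_ ?_
  · have := hp.unique (hq'.of_forall_eq fun n => by ring)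
    linear_combination this
  · have h4 : (m.factorial : ℂ) ≠ 0 := by exact_mod_cast m.factorial_ne_zero
    have h5 : (m + 1 : ℂ) ≠ 0 := by exact_mod_cast m.succ_ne_zero
    simp only [add_zero, Nat.factorial_succ]
    push_cast
    field_simp
    ring
  · intro n
    have h3 := succ_mul_legendreCoeff_succ lam n
    have h4 : ((m + n).factorial : ℂ) ≠ 0 := by exact_mod_cast (m + n).factorial_ne_zero
    have h5 : (m + n + 1 : ℂ) ≠ 0 := by exact_mod_cast (m + n).succ_ne_zero
    have h6 : (m + n + 1 + 1 : ℂ) ≠ 0 := by exact_mod_cast (m + n + 1).succ_ne_zero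
    have h7 : (n + 1 : ℂ) ≠ 0 := by exact_mod_cast n.succ_ne_zero
    rw [show m + 1 + (n + 1) = m + n + 1 + 1 by ring, show m + (n + 1) = m + n + 1 by ring,
      show m + 1 + n = m + n + 1 by ring, show m + 2 + n = m + n + 1 + 1 by ring,
      Nat.factorial_succ (m + n + 1), Nat.factorial_succ (m + n)]
    push_cast
    field_simp
    linear_combination h3

theorem hasDerivAt_hypDeriv {lam : ℂ} (hlam : ∀ n : ℤ, lam ≠ (n : ℂ)) (m : ℕ) {x : ℂ}
    (hx : ‖x‖ < 1) : HasDerivAt (hypDeriv lam m) (hypDeriv lam (m + 1) x) x := by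
  obtain ⟨d, hd, h⟩ := hasDerivAt_scaledHyp hlam m hx
  have hx1 : 1 - x ≠ 0 := by
    intro h0
    rw [← sub_eq_zero.mp h0, norm_one] at hx
    exact lt_irrefl _ hx
  have h1 : HasDerivAt (fun y : ℂ => ((1 - y) ^ m)⁻¹) (m * ((1 - x) ^ (m + 1))⁻¹) x := by
    have h2 : HasDerivAt (fun y : ℂ => ((1 - y) ^ m)⁻¹) _ x :=
      (((hasDerivAt_id' x).const_sub 1).fun_pow m).fun_inv (pow_ne_zero m hx1)
    refine h2.congr_deriv ?_
    rcases m with _ | m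
    · simp
    · simp only [Nat.add_sub_cancel]
      field_simp
      ring
  have h2 : HasDerivAt (fun y => pochProd lam m * ((1 - y) ^ m)⁻¹ * scaledHyp lam m y) _ x :=
    (h1.const_mul (pochProd lam m)).mul hd
  refine h2.congr_deriv ?_
  have h3 : scaledHyp lam (m + 1) x * ((m - lam) * (m + 1 + lam)) =
    (1 - x) * d + m * scaledHyp lam m x := by rw [h]; ring
  rw [hypDeriv, pochProd_succ]
  calc _ = pochProd lam m * ((1 - x) ^ (m + 1))⁻¹ *
        ((1 - x) * d + m * scaledHyp lam m x) := by
          field_simp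
          ring
    _ = _ := by
        rw [← h3]
        ring

theorem hypDeriv_ode {lam : ℂ} (hlam : ∀ n : ℤ, lam ≠ (n : ℂ)) (m : ℕ) {x : ℂ}
    (hx : ‖x‖ < 1) :
    x * (1 - x) * hypDeriv lam (m + 2) x + (m + 1) * (1 - 2 * x) * hypDeriv lam (m + 1) x
      + (lam * (lam + 1) - m * (m + 1)) * hypDeriv lam m x = 0 := by
  have h := scaledHyp_contiguous hlam m hx
  have hx1 : 1 - x ≠ 0 := by
    intro h0
    rw [← sub_eq_zero.mp h0, norm_one] at hx
    exact lt_irrefl _ hx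
  simp only [hypDeriv, pochProd_succ]
  obtain ⟨i, hi⟩ : ∃ i, i = ((1 - x) ^ (m + 1))⁻¹ := ⟨_, rfl⟩
  have h0 : ((1 - x) ^ m)⁻¹ = i * (1 - x) := by
    rw [hi]
    field_simp
    ring
  have h2 : (1 - x) * ((1 - x) ^ (m + 2))⁻¹ = i := by
    rw [hi]
    field_simp
    ring
  rw [h0, ← hi]
  push_cast
  linear_combination (lam * (lam + 1) - m * (m + 1)) * pochProd lam m * i * h
    + x * (pochProd lam m * ((m - lam) * (m + 1 + lam)) * ((m + 1 - lam) * (m + 1 + 1 + lam))) *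
      scaledHyp lam (m + 2) x * h2

/-- The Wronskian of `hypDeriv lam m x` and `hypDeriv lam m (1 - x)`, with its weight. -/
noncomputable def hypWronskian (lam : ℂ) (m : ℕ) (x : ℂ) : ℂ :=
  (x * (1 - x)) ^ (m + 1) * (hypDeriv lam m x * hypDeriv lam (m + 1) (1 - x)
    + hypDeriv lam (m + 1) x * hypDeriv lam m (1 - x))

theorem hypWronskian_succ {lam : ℂ} (hlam : ∀ n : ℤ, lam ≠ (n : ℂ)) (m : ℕ) {x : ℂ}
    (hx : ‖x‖ < 1) (hx' : ‖1 - x‖ < 1) :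
    hypWronskian lam (m + 1) x = (m - lam) * (m + 1 + lam) * hypWronskian lam m x := by
  have h1 := hypDeriv_ode hlam m hx
  have h2 := hypDeriv_ode hlam m hx'
  simp only [hypWronskian]
  linear_combination (x * (1 - x)) ^ (m + 1) *
    (hypDeriv lam (m + 1) x * h2 + hypDeriv lam (m + 1) (1 - x) * h1)

theorem hypWronskian_eq_pochProd_mul {lam : ℂ} (hlam : ∀ n : ℤ, lam ≠ (n : ℂ)) (m : ℕ) {x : ℂ}
    (hx : ‖x‖ < 1) (hx' : ‖1 - x‖ < 1) :
    hypWronskian lam m x = pochProd lam m * hypWronskian lam 0 x := by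
  induction m with
  | zero => simp [pochProd]
  | succ m ih =>
    rw [hypWronskian_succ hlam m hx hx', ih, pochProd_succ]
    ring

theorem hasDerivAt_hypDeriv_one_sub {lam : ℂ} (hlam : ∀ n : ℤ, lam ≠ (n : ℂ)) (m : ℕ) {x : ℂ}
    (hx : ‖1 - x‖ < 1) :
    HasDerivAt (fun y => hypDeriv lam m (1 - y)) (-hypDeriv lam (m + 1) (1 - x)) x :=
  HasDerivAt.comp_const_sub 1 x (hasDerivAt_hypDeriv hlam m hx)

theorem hasDerivAt_hypWronskian_zero {lam : ℂ} (hlam : ∀ n : ℤ, lam ≠ (n : ℂ)) {x : ℂ}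
    (hx : ‖x‖ < 1) (hx' : ‖1 - x‖ < 1) : HasDerivAt (hypWronskian lam 0) 0 x := by
  have h := (((hasDerivAt_id' x).fun_mul ((hasDerivAt_id' x).const_sub 1)).fun_pow 1).fun_mul
    (((hasDerivAt_hypDeriv hlam 0 hx).fun_mul (hasDerivAt_hypDeriv_one_sub hlam 1 hx')).fun_add
      ((hasDerivAt_hypDeriv hlam 1 hx).fun_mul (hasDerivAt_hypDeriv_one_sub hlam 0 hx')))
  refine HasDerivAt.congr_deriv (f := hypWronskian lam 0) h ?_
  have h1 := hypDeriv_ode hlam 0 hx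
  have h2 := hypDeriv_ode hlam 0 hx'
  norm_num at h1 h2 ⊢
  linear_combination hypDeriv lam 0 (1 - x) * h1 - hypDeriv lam 0 x * h2

theorem hypWronskian_zero_eq {lam : ℂ} (hlam : ∀ n : ℤ, lam ≠ (n : ℂ)) {x y : ℂ}
    (hx : ‖x‖ < 1) (hx' : ‖1 - x‖ < 1) (hy : ‖y‖ < 1) (hy' : ‖1 - y‖ < 1) :
    hypWronskian lam 0 x = hypWronskian lam 0 y := by
  have hopen : IsOpen (Metric.ball (0 : ℂ) 1 ∩ Metric.ball 1 1) :=
    Metric.isOpen_ball.inter Metric.isOpen_ball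
  have hconv : Convex ℝ (Metric.ball (0 : ℂ) 1 ∩ Metric.ball 1 1) :=
    (convex_ball _ _).inter (convex_ball _ _)
  have hd : ∀ z ∈ Metric.ball (0 : ℂ) 1 ∩ Metric.ball 1 1,
      HasDerivAt (hypWronskian lam 0) 0 z := fun z hz =>
    hasDerivAt_hypWronskian_zero hlam (mem_ball_zero_iff.mp hz.1)
      (by rw [norm_sub_rev]; exact mem_ball_iff_norm.mp hz.2)
  refine hopen.is_const_of_deriv_eq_zero hconv.isPreconnected
    (fun z hz => (hd z hz).differentiableAt.differentiableWithinAt)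
    (fun z hz => (hd z hz).deriv) ⟨?_, ?_⟩ ⟨?_, ?_⟩
  · exact mem_ball_zero_iff.mpr hx
  · rw [mem_ball_iff_norm, norm_sub_rev]; exact hx'
  · exact mem_ball_zero_iff.mpr hy
  · rw [mem_ball_iff_norm, norm_sub_rev]; exact hy'

theorem ascPochhammer_eval_eq_prod (s : ℂ) (n : ℕ) :
    (ascPochhammer ℂ n).eval s = ∏ j ∈ Finset.range n, (s + j) := by
  induction n with
  | zero => simp
  | succ n ih => rw [ascPochhammer_succ_eval, ih, Finset.prod_range_succ]

theorem GammaSeq_mul_GammaSeq {lam : ℂ} {n : ℕ} (hn : n ≠ 0) :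
    Complex.GammaSeq (-lam) n * Complex.GammaSeq (1 + lam) n =
      n * (n.factorial : ℂ) ^ 2 / pochProd lam (n + 1) := by
  have h0 : (n : ℂ) ≠ 0 := by exact_mod_cast hn
  have h1 : (n : ℂ) ^ (-lam) * (n : ℂ) ^ (1 + lam) = n := by
    rw [← Complex.cpow_add _ _ h0]
    simp
  rw [Complex.GammaSeq, Complex.GammaSeq, pochProd, div_mul_div_comm,
    ← ascPochhammer_eval_eq_prod, ← ascPochhammer_eval_eq_prod]
  congr 1
  linear_combination (n.factorial : ℂ) ^ 2 * h1

theorem tendsto_mul_pochProd {lam : ℂ} (hlam : ∀ n : ℤ, lam ≠ (n : ℂ)) :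
    Tendsto (fun n : ℕ => n * (legendreCoeff lam n / (n.factorial : ℂ))) atTop
      (𝓝 (Complex.Gamma (-lam) * Complex.Gamma (1 + lam))⁻¹) := by
  have hg1 : Complex.Gamma (-lam) ≠ 0 := Complex.Gamma_ne_zero fun k h =>
    hlam k (by push_cast; linear_combination -h)
  have hg2 : Complex.Gamma (1 + lam) ≠ 0 := Complex.Gamma_ne_zero fun k h =>
    hlam (-(k + 1)) (by push_cast; linear_combination h)
  have h1 := (((Complex.GammaSeq_tendsto_Gamma (-lam)).mul
    (Complex.GammaSeq_tendsto_Gamma (1 + lam))).inv₀ (mul_ne_zero hg1 hg2)).mul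
    (((tendsto_natCast_add_div_natCast_add 0 (-lam)).mul
      (tendsto_natCast_add_div_natCast_add 0 (1 + lam))))
  rw [one_mul, mul_one] at h1
  refine h1.congr' ?_
  filter_upwards [eventually_ne_atTop 0] with n hn
  have h0 : (n : ℂ) ≠ 0 := by exact_mod_cast hn
  have hf : (n.factorial : ℂ) ≠ 0 := by exact_mod_cast n.factorial_ne_zero
  have hp := pochProd_ne_zero hlam n
  have h2 : (n : ℂ) - lam ≠ 0 := fun h => hlam n (by push_cast; linear_combination -h)
  have h3 : (n : ℂ) + 1 + lam ≠ 0 := fun h => hlam (-(n + 1)) (by push_cast; linear_combination h)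
  rw [GammaSeq_mul_GammaSeq hn, legendreCoeff_eq, pochProd_succ, add_zero, ← sub_eq_add_neg,
    ← add_assoc]
  field_simp

theorem sum_range_scaledHyp_one (lam : ℂ) (n : ℕ) :
    ∑ k ∈ Finset.range n, pochProd lam 1 * (legendreCoeff lam k / ((1 + k).factorial : ℂ)) =
      n * (legendreCoeff lam n / (n.factorial : ℂ)) := by
  induction n with
  | zero => simp
  | succ n ih =>
    have h1 := succ_mul_legendreCoeff_succ lam n
    have h2 : (n.factorial : ℂ) ≠ 0 := by exact_mod_cast n.factorial_ne_zero
    have h3 : (n + 1 : ℂ) ≠ 0 := by exact_mod_cast n.succ_ne_zero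
    rw [Finset.sum_range_succ, ih, add_comm 1 n, Nat.factorial_succ, pochProd_succ]
    simp only [pochProd, ascPochhammer_zero, Polynomial.eval_one]
    push_cast
    field_simp
    linear_combination -h1

theorem tendsto_scaledHyp_one {lam : ℂ} (hlam : ∀ n : ℤ, lam ≠ (n : ℂ)) :
    Tendsto (fun x => pochProd lam 1 * scaledHyp lam 1 x)
      ((𝓝[<] (1 : ℝ)).map Complex.ofReal)
      (𝓝 (Complex.Gamma (-lam) * Complex.Gamma (1 + lam))⁻¹) := by
  have h := Complex.tendsto_tsum_powerSeries_nhdsWithin_lt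
    ((tendsto_mul_pochProd hlam).congr fun n => (sum_range_scaledHyp_one lam n).symm)
  refine h.congr fun x => ?_
  rw [scaledHyp, ← tsum_mul_left]
  exact tsum_congr fun n => by ring

theorem tendsto_one_sub_mul_scaledHyp_zero {lam : ℂ} (hlam : ∀ n : ℤ, lam ≠ (n : ℂ)) :
    Tendsto (fun x => (1 - x) * scaledHyp lam 0 x)
      ((𝓝[<] (1 : ℝ)).map Complex.ofReal) (𝓝 0) := by
  have h0 : Tendsto (fun n : ℕ => legendreCoeff lam n / (n.factorial : ℂ)) atTop (𝓝 0) := by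
    have h := (tendsto_mul_pochProd hlam).mul (tendsto_inv_atTop_nhds_zero_nat (𝕜 := ℂ))
    rw [mul_zero] at h
    refine h.congr' ?_
    filter_upwards [eventually_ne_atTop 0] with n hn
    have h0 : (n : ℂ) ≠ 0 := by exact_mod_cast hn
    field_simp
  let p : ℕ → ℂ := fun n => Nat.casesOn n 0 fun k => legendreCoeff lam k / (k.factorial : ℂ)
  have hsum : ∀ n : ℕ, ∑ k ∈ Finset.range (n + 1),
      (legendreCoeff lam k / (k.factorial : ℂ) - p k) = legendreCoeff lam n / (n.factorial : ℂ) := by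
    intro n
    induction n with
    | zero => simp [p]
    | succ n ih =>
      rw [Finset.sum_range_succ, ih]
      simp only [p]
      ring
  have h := Complex.tendsto_tsum_powerSeries_nhdsWithin_lt
    ((tendsto_add_atTop_iff_nat 1).mp (h0.congr fun n => (hsum n).symm))
  refine h.congr' ?_
  rw [EventuallyEq, eventually_map]
  filter_upwards [Ioo_mem_nhdsLT (show (0 : ℝ) < 1 by norm_num)] with x hx
  have hx1 : ‖(x : ℂ)‖ < 1 := by
    rw [Complex.norm_real, Real.norm_of_nonneg hx.1.le]
    exact hx.2
  have h1 := hasSum_scaledHyp hlam 0 hx1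
  simp only [zero_add] at h1
  have h2 := hasSum_mul_pow_of_shift (p := p) h1 rfl fun n => rfl
  have h3 := (h1.sub h2).of_forall_eq
    (f := fun n => (legendreCoeff lam n / (n.factorial : ℂ) - p n) * (x : ℂ) ^ n)
    fun n => by ring
  rw [h3.tsum_eq]
  ring

theorem hypWronskian_zero {lam : ℂ} (hlam : ∀ n : ℤ, lam ≠ (n : ℂ)) {x : ℂ}
    (hx : ‖x‖ < 1) (hx' : ‖1 - x‖ < 1) :
    hypWronskian lam 0 x = (Complex.Gamma (-lam) * Complex.Gamma (1 + lam))⁻¹ := by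
  have hid : Tendsto (fun x : ℂ => x) ((𝓝[<] (1 : ℝ)).map Complex.ofReal) (𝓝 1) := by
    rw [tendsto_map'_iff]
    exact (Complex.continuous_ofReal.tendsto' 1 1 Complex.ofReal_one).mono_left nhdsWithin_le_nhds
  have hid' : Tendsto (fun x : ℂ => 1 - x) ((𝓝[<] (1 : ℝ)).map Complex.ofReal) (𝓝 0) := by
    simpa using hid.const_sub 1
  have hc : ∀ m, Tendsto (fun x => hypDeriv lam m (1 - x))
      ((𝓝[<] (1 : ℝ)).map Complex.ofReal) (𝓝 (hypDeriv lam m 0)) := fun m =>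
    (hasDerivAt_hypDeriv hlam m (by simp)).continuousAt.tendsto.comp hid'
  have h0 : hypDeriv lam 0 0 = 1 := by
    rw [hypDeriv, scaledHyp, tsum_eq_single 0 (fun n hn => by simp [hn])]
    simp [pochProd, legendreCoeff]
  have hlim := hid.mul (((tendsto_one_sub_mul_scaledHyp_zero hlam).mul (hc 1)).add
    ((tendsto_scaledHyp_one hlam).mul (hc 0)))
  rw [h0, zero_mul, zero_add, one_mul, mul_one] at hlim
  refine tendsto_nhds_unique (Tendsto.congr' ?_ tendsto_const_nhds) hlim
  rw [EventuallyEq, eventually_map]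
  filter_upwards [Ioo_mem_nhdsLT (show (0 : ℝ) < 1 by norm_num)] with y hy
  have hy1 : ‖(y : ℂ)‖ < 1 := by
    rw [Complex.norm_real, Real.norm_of_nonneg hy.1.le]
    exact hy.2
  have hy2 : ‖(1 - y : ℂ)‖ < 1 := by
    rw [← Complex.ofReal_one, ← Complex.ofReal_sub, Complex.norm_real,
      Real.norm_of_nonneg (by linarith [hy.2])]
    linarith [hy.1]
  have hy3 : (1 - y : ℂ) ≠ 0 := by
    rw [← Complex.ofReal_one, ← Complex.ofReal_sub]
    exact_mod_cast (by linarith [hy.2] : 0 < 1 - y).ne'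
  rw [hypWronskian_zero_eq hlam hx hx' hy1 hy2, hypWronskian]
  have e0 : hypDeriv lam 0 y = scaledHyp lam 0 y := by simp [hypDeriv, pochProd]
  have e1 : (1 - y : ℂ) * hypDeriv lam 1 y = pochProd lam 1 * scaledHyp lam 1 y := by
    rw [hypDeriv]
    field_simp
  rw [e0, zero_add, pow_one]
  linear_combination y * hypDeriv lam 0 (1 - y) * e1

theorem hypWronskian_eq {lam : ℂ} (hlam : ∀ n : ℤ, lam ≠ (n : ℂ)) (m : ℕ) {x : ℂ}
    (hx : ‖x‖ < 1) (hx' : ‖1 - x‖ < 1) :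
    hypWronskian lam m x =
      pochProd lam m * (Complex.Gamma (-lam) * Complex.Gamma (1 + lam))⁻¹ := by
  rw [hypWronskian_eq_pochProd_mul hlam m hx hx', hypWronskian_zero hlam hx hx']

end LegendreFunctions

section Completeness

open Filter Topology Polynomial

theorem Polynomial.intervalIntegrable_eval_mul {g : ℝ → ℂ} {a b : ℝ}
    (hg : ContinuousOn g (Set.uIcc a b)) (p : ℝ[X]) :
    IntervalIntegrable (fun z => ((p.eval z : ℝ) : ℂ) * g z) MeasureTheory.volume a b :=
  ContinuousOn.intervalIntegrable
    ((Complex.continuous_ofReal.comp p.continuous).continuousOn.mul hg)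

theorem eq_zero_of_integral_mul_self_eq_zero {f : ℝ → ℝ} (hf : ContinuousOn f (Set.Icc (-1) 1))
    (h : ∫ z in (-1 : ℝ)..1, f z * f z = 0) {z : ℝ} (hz : z ∈ Set.Icc (-1 : ℝ) 1) : f z = 0 := by
  by_contra hne
  have := intervalIntegral.integral_pos (f := fun z => f z * f z) (a := -1) (b := 1) (by norm_num)
    (hf.mul hf) (fun x _ => mul_self_nonneg _) ⟨z, hz, mul_self_pos.mpr hne⟩
  exact this.ne' h

theorem eq_zero_of_integral_mul_polynomial_real {f : ℝ → ℝ} (hf : ContinuousOn f (Set.Icc (-1) 1))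
    (h : ∀ p : ℝ[X], ∫ z in (-1 : ℝ)..1, p.eval z * f z = 0) {z : ℝ}
    (hz : z ∈ Set.Icc (-1 : ℝ) 1) : f z = 0 := by
  refine eq_zero_of_integral_mul_self_eq_zero hf ?_ hz
  have hI : Set.uIcc (-1 : ℝ) 1 = Set.Icc (-1) 1 := Set.uIcc_of_le (by norm_num)
  have hf' : ContinuousOn f (Set.uIcc (-1) 1) := by rwa [hI]
  obtain ⟨C, hC⟩ := isCompact_Icc.exists_bound_of_continuousOn hf
  have hC0 : 0 ≤ C := (norm_nonneg _).trans (hC z hz)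
  refine abs_nonpos_iff.mp (le_of_forall_pos_le_add fun ε hε => ?_)
  obtain ⟨p, hp⟩ := exists_polynomial_near_of_continuousOn (-1) 1 f hf (ε / (2 * (C + 1)))
    (by positivity)
  have hint : ∫ z in (-1 : ℝ)..1, f z * f z = ∫ z in (-1 : ℝ)..1, (f z - p.eval z) * f z := by
    have := intervalIntegral.integral_sub (a := -1) (b := 1) (μ := MeasureTheory.volume)
      (f := fun z => f z * f z) (g := fun z => p.eval z * f z)
      (hf'.mul hf').intervalIntegrable (p.continuous.continuousOn.mul hf').intervalIntegrable
    rw [h p, sub_zero] at this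
    rw [← this]
    exact intervalIntegral.integral_congr fun z _ => by ring
  rw [hint, zero_add]
  have hb := intervalIntegral.norm_integral_le_of_norm_le_const (a := -1) (b := 1)
    (f := fun z => (f z - p.eval z) * f z) (C := ε / (2 * (C + 1)) * C) fun z hz => by
      rw [Set.uIoc_of_le (by norm_num)] at hz
      have hz' := Set.Ioc_subset_Icc_self hz
      rw [norm_mul]
      have h1 : ‖f z - p.eval z‖ ≤ ε / (2 * (C + 1)) := by
        rw [norm_sub_rev]
        exact (hp z hz').le
      have h2 := hC z hz'
      gcongr
  refine (Real.norm_eq_abs _).symm.le.trans (hb.trans ?_)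
  rw [abs_of_pos (by norm_num)]
  have h3 : ε / (2 * (C + 1)) * C * (1 - -1) = ε * (C / (C + 1)) := by
    field_simp
    ring
  rw [h3]
  exact mul_le_of_le_one_right hε.le ((div_le_one (by positivity)).mpr (by linarith))

theorem eq_zero_of_integral_mul_polynomial {f : ℝ → ℂ} (hf : ContinuousOn f (Set.Icc (-1) 1))
    (h : ∀ p : ℝ[X], ∫ z in (-1 : ℝ)..1, ((p.eval z : ℝ) : ℂ) * f z = 0) {z : ℝ}
    (hz : z ∈ Set.Icc (-1 : ℝ) 1) : f z = 0 := by
  have hI : Set.uIcc (-1 : ℝ) 1 = Set.Icc (-1) 1 := Set.uIcc_of_le (by norm_num)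
  have hf' : ContinuousOn f (Set.uIcc (-1) 1) := by rwa [hI]
  refine Complex.ext ?_ ?_
  · refine eq_zero_of_integral_mul_polynomial_real (f := fun z => (f z).re)
      (Complex.continuous_re.comp_continuousOn hf) (fun p => ?_) hz
    have := Complex.reCLM.intervalIntegral_comp_comm
      (p.intervalIntegrable_eval_mul (a := -1) (b := 1) hf')
    rw [h p] at this
    simpa using this
  · refine eq_zero_of_integral_mul_polynomial_real (f := fun z => (f z).im)
      (Complex.continuous_im.comp_continuousOn hf) (fun p => ?_) hz
    have := Complex.imCLM.intervalIntegral_comp_comm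
      (p.intervalIntegrable_eval_mul (a := -1) (b := 1) hf')
    rw [h p] at this
    simpa using this

/-- The squared norm of `legendreDeriv (m + k) m` with respect to the weight `(1 - z²)ᵐ`. -/
noncomputable def legendreDerivNormSq (m k : ℕ) : ℝ :=
  polyIntegral ((1 - X ^ 2) ^ m * legendreDeriv (m + k) m * legendreDeriv (m + k) m)

theorem legendreDerivNormSq_pos (m k : ℕ) : 0 < legendreDerivNormSq m k :=
  polyIntegral_legendreDeriv_sq_pos k m

/-- The pairing of a function with `legendreDeriv (m + k) m` for the weight `(1 - z²)ᵐ`. -/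
noncomputable def legendreDerivCoeff (m : ℕ) (g : ℝ → ℂ) (k : ℕ) : ℂ :=
  ∫ z in (-1 : ℝ)..1, ((((1 - X ^ 2) ^ m * legendreDeriv (m + k) m).eval z : ℝ) : ℂ) * g z

theorem hasSum_legendreDerivCoeff_mul (m : ℕ) {g : ℝ → ℂ} (hg : ContinuousOn g (Set.uIcc (-1) 1))
    (p : ℝ[X]) :
    HasSum (fun k => legendreDerivCoeff m g k / legendreDerivNormSq m k *
        (polyIntegral ((1 - X ^ 2) ^ m * legendreDeriv (m + k) m * p) : ℂ))
      (∫ z in (-1 : ℝ)..1, ((((1 - X ^ 2) ^ m * p).eval z : ℝ) : ℂ) * g z) := by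
  obtain ⟨n, hn⟩ : ∃ n : ℕ, p.degree < n := ⟨p.natDegree + 1, by
    exact_mod_cast p.degree_le_natDegree.trans_lt (by exact_mod_cast p.natDegree.lt_succ_self)⟩
  have hp := mem_span_legendreDeriv m n hn
  clear hn
  induction hp using Submodule.span_induction with
  | mem x hx =>
    obtain ⟨j, -, rfl⟩ := hx
    have hne : ((legendreDerivNormSq m j : ℝ) : ℂ) ≠ 0 := by
      exact_mod_cast (legendreDerivNormSq_pos m j).ne'
    convert hasSum_single (α := ℂ) j fun k hk => ?_ using 1
    · change legendreDerivCoeff m g j =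
        legendreDerivCoeff m g j / legendreDerivNormSq m j * (legendreDerivNormSq m j : ℂ)
      field_simp
    · rw [polyIntegral_legendreDeriv_orthogonal m hk]
      simp
  | zero => simp
  | add x y _ _ ihx ihy =>
    have := ihx.add ihy
    rw [← intervalIntegral.integral_add (Polynomial.intervalIntegrable_eval_mul hg _)
      (Polynomial.intervalIntegrable_eval_mul hg _)] at this
    convert! this using 1
    · funext k
      rw [mul_add, map_add]
      push_cast
      ring
    · refine intervalIntegral.integral_congr fun z _ => ?_
      simp only [mul_add, eval_add]
      push_cast
      ring
  | smul c x _ ih =>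
    have := ih.mul_left (c : ℂ)
    rw [← intervalIntegral.integral_const_mul] at this
    convert! this using 1
    · funext k
      rw [mul_smul_comm, map_smul, smul_eq_mul]
      push_cast
      ring
    · refine intervalIntegral.integral_congr fun z _ => ?_
      simp only [mul_smul_comm, eval_smul, smul_eq_mul]
      push_cast
      ring

/-- A continuous function whose weighted expansion in the derivatives of the Legendre polynomials
is dominated by a summable sequence is the sum of that expansion. -/
theorem hasSum_legendreDeriv_expansion (m : ℕ) {g : ℝ → ℂ}
    (hg : ContinuousOn g (Set.Icc (-1) 1)) {B : ℕ → ℝ} (hB : Summable B)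
    (hbound : ∀ k, ∀ z ∈ Set.Icc (-1 : ℝ) 1,
      ‖(((1 - z ^ 2) ^ (2 * m + 1) * (legendreDeriv (m + k) m).eval z : ℝ) : ℂ) *
        (legendreDerivCoeff m g k / legendreDerivNormSq m k)‖ ≤ B k)
    {z : ℝ} (hz : z ∈ Set.Ioo (-1 : ℝ) 1) :
    HasSum (fun k => (((legendreDeriv (m + k) m).eval z : ℝ) : ℂ) *
      (legendreDerivCoeff m g k / legendreDerivNormSq m k)) (g z) := by
  have hI : Set.uIcc (-1 : ℝ) 1 = Set.Icc (-1) 1 := Set.uIcc_of_le (by norm_num)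
  have hg' : ContinuousOn g (Set.uIcc (-1) 1) := by rwa [hI]
  set F : ℕ → ℝ → ℂ := fun k z =>
    (((1 - z ^ 2) ^ (2 * m + 1) * (legendreDeriv (m + k) m).eval z : ℝ) : ℂ) *
      (legendreDerivCoeff m g k / legendreDerivNormSq m k) with hF
  have hFc : ∀ k, Continuous (F k) := fun k => by
    have := (legendreDeriv (m + k) m).continuous
    fun_prop
  have hFs : ∀ x ∈ Set.Icc (-1 : ℝ) 1, HasSum (fun k => F k x) (∑' k, F k x) := fun x hx =>
    (Summable.of_norm_bounded hB fun k => hbound k x hx).hasSum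
  have hSc : ContinuousOn (fun x => ∑' k, F k x) (Set.Icc (-1) 1) :=
    continuousOn_tsum (fun k => (hFc k).continuousOn) hB hbound
  have hw : Continuous fun x : ℝ => (((1 - x ^ 2) ^ (2 * m + 1) : ℝ) : ℂ) := by fun_prop
  have hzero := eq_zero_of_integral_mul_polynomial
    (f := fun x => (((1 - x ^ 2) ^ (2 * m + 1) : ℝ) : ℂ) * g x - ∑' k, F k x)
    ((hw.continuousOn.mul hg).sub hSc) (fun p => ?_) (Set.Ioo_subset_Icc_self hz)
  · have h1 := hFs z (Set.Ioo_subset_Icc_self hz)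
    rw [← sub_eq_zero.mp hzero] at h1
    have hpos : ((((1 - z ^ 2) ^ (2 * m + 1) : ℝ)) : ℂ) ≠ 0 := by
      have : 0 < 1 - z ^ 2 := by nlinarith [hz.1, hz.2]
      exact_mod_cast (pow_pos this _).ne'
    rw [← hasSum_mul_left_iff hpos]
    convert! h1 using 2 with k
    rw [hF]
    push_cast
    ring
  · obtain ⟨C, hC⟩ := isCompact_Icc.exists_bound_of_continuousOn
      (s := Set.Icc (-1 : ℝ) 1) p.continuous.continuousOn
    have h1 : HasSum (fun k => ∫ x in (-1 : ℝ)..1, ((p.eval x : ℝ) : ℂ) * F k x)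
        (∫ x in (-1 : ℝ)..1, ((p.eval x : ℝ) : ℂ) * ∑' k, F k x) := by
      refine intervalIntegral.hasSum_integral_of_dominated_convergence (fun k _ => C * B k)
        (fun k => ?_) (fun k => ?_) ?_ ?_ ?_
      · have := hFc k
        have := p.continuous
        exact Continuous.aestronglyMeasurable (by fun_prop)
      · refine Eventually.of_forall fun x hx => ?_
        rw [Set.uIoc_of_le (by norm_num)] at hx
        have hx' := Set.Ioc_subset_Icc_self hx
        rw [norm_mul, Complex.norm_real]
        exact mul_le_mul (hC x hx') (hbound k x hx') (norm_nonneg _)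
          ((norm_nonneg _).trans (hC x hx'))
      · exact Eventually.of_forall fun x _ => hB.mul_left C
      · simp
      · refine Eventually.of_forall fun x hx => ?_
        rw [Set.uIoc_of_le (by norm_num)] at hx
        exact (hFs x (Set.Ioc_subset_Icc_self hx)).mul_left _
    have h2 := hasSum_legendreDerivCoeff_mul m hg' ((1 - X ^ 2) ^ (m + 1) * p)
    have h3 : (fun k => ∫ x in (-1 : ℝ)..1, ((p.eval x : ℝ) : ℂ) * F k x) = fun k =>
        legendreDerivCoeff m g k / legendreDerivNormSq m k *
        (polyIntegral ((1 - X ^ 2) ^ m * legendreDeriv (m + k) m *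
          ((1 - X ^ 2) ^ (m + 1) * p)) : ℂ) := by
      funext k
      rw [polyIntegral_apply, ← intervalIntegral.integral_ofReal,
        ← intervalIntegral.integral_const_mul]
      refine intervalIntegral.integral_congr fun x _ => ?_
      simp only [hF, eval_mul, eval_pow, eval_sub, eval_one, eval_X]
      push_cast
      ring
    rw [h3] at h1
    have h4 := h1.unique h2
    simp only [mul_sub]
    rw [intervalIntegral.integral_sub, h4, sub_eq_zero]
    · refine intervalIntegral.integral_congr fun x _ => ?_
      simp only [eval_mul, eval_pow, eval_sub, eval_one, eval_X]
      push_cast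
      ring
    · exact Polynomial.intervalIntegrable_eval_mul (by rw [hI]; exact hw.continuousOn.mul hg) p
    · exact Polynomial.intervalIntegrable_eval_mul (by rw [hI]; exact hSc) p

end Completeness

section GreenFunction

open Filter Topology Polynomial

/-- The solution of the `m` times differentiated Legendre equation that is regular at `z = 1`. -/
noncomputable def legendreSol (lam : ℂ) (m : ℕ) (z : ℝ) : ℂ :=
  hypDeriv lam m (((1 - z) / 2 : ℝ) : ℂ)

theorem hypDeriv_one_sub_div_two (lam : ℂ) (m : ℕ) (z : ℝ) :
    hypDeriv lam m (((1 - z) / 2 : ℝ) : ℂ) = legendreSol lam m z := rfl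

theorem norm_one_sub_div_two_lt_one {z : ℝ} (hz : z ∈ Set.Ioc (-1 : ℝ) 1) :
    ‖(((1 - z) / 2 : ℝ) : ℂ)‖ < 1 := by
  rw [Complex.norm_real, Real.norm_of_nonneg (by linarith [hz.2])]
  linarith [hz.1]

theorem hasDerivAt_legendreSol {lam : ℂ} (hlam : ∀ n : ℤ, lam ≠ (n : ℂ)) (m : ℕ) {z : ℝ}
    (hz : z ∈ Set.Ioc (-1 : ℝ) 1) :
    HasDerivAt (legendreSol lam m) (-(1 / 2) * legendreSol lam (m + 1) z) z := by
  have h1 : HasDerivAt (fun y : ℝ => (((1 - y) / 2 : ℝ) : ℂ)) (((-1 / 2 : ℝ)) : ℂ) z :=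
    (((hasDerivAt_id' z).const_sub 1).div_const 2).ofReal_comp
  have h2 := HasDerivAt.scomp z
    (h := fun y : ℝ => (((1 - y) / 2 : ℝ) : ℂ))
    (hasDerivAt_hypDeriv hlam m (norm_one_sub_div_two_lt_one hz)) h1
  refine HasDerivAt.congr_deriv (f := legendreSol lam m) h2 ?_
  rw [legendreSol, smul_eq_mul]
  push_cast
  ring

theorem legendreSol_ode {lam : ℂ} (hlam : ∀ n : ℤ, lam ≠ (n : ℂ)) (m : ℕ) {z : ℝ}
    (hz : z ∈ Set.Ioc (-1 : ℝ) 1) :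
    (1 - (z : ℂ) ^ 2) * legendreSol lam (m + 2) z + 4 * (m + 1) * z * legendreSol lam (m + 1) z
      + 4 * (lam * (lam + 1) - m * (m + 1)) * legendreSol lam m z = 0 := by
  have h := hypDeriv_ode hlam m (norm_one_sub_div_two_lt_one hz)
  simp only [hypDeriv_one_sub_div_two] at h
  push_cast at h
  linear_combination 4 * h

/-- The Lagrange bilinear concomitant of `legendreSol lam m` and a polynomial. -/
noncomputable def lagrangeConcomitant (lam : ℂ) (m : ℕ) (q : ℝ[X]) (z : ℝ) : ℂ :=
  (((1 - z ^ 2) ^ (m + 1) * q.eval z : ℝ) : ℂ) * (-(1 / 2) * legendreSol lam (m + 1) z) -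
    ((((1 - X ^ 2) ^ (m + 1) * derivative q).eval z : ℝ) : ℂ) * legendreSol lam m z

theorem hasDerivAt_lagrangeConcomitant {lam : ℂ} (hlam : ∀ n : ℤ, lam ≠ (n : ℂ)) (m : ℕ)
    {q : ℝ[X]} {c : ℝ} (hq : derivative ((1 - X ^ 2) ^ (m + 1) * derivative q) =
      -(C (c - m * (m + 1)) * ((1 - X ^ 2) ^ m * q))) {z : ℝ} (hz : z ∈ Set.Ioc (-1 : ℝ) 1) :
    HasDerivAt (lagrangeConcomitant lam m q)
      ((c - lam * (lam + 1)) * (((((1 - X ^ 2) ^ m * q).eval z : ℝ) : ℂ) * legendreSol lam m z))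
      z := by
  have hw : HasDerivAt (fun z : ℝ => (1 - z ^ 2) ^ (m + 1) * q.eval z)
      ((m + 1) * (1 - z ^ 2) ^ m * (-(2 * z)) * q.eval z +
        (1 - z ^ 2) ^ (m + 1) * (derivative q).eval z) z := by
    refine HasDerivAt.congr_deriv
      (((((hasDerivAt_id' z).fun_pow 2).const_sub 1).fun_pow (m + 1)).fun_mul (q.hasDerivAt z)) ?_
    simp
  have h := (hw.ofReal_comp.fun_mul ((hasDerivAt_legendreSol hlam (m + 1) hz).const_mul
    (-(1 / 2) : ℂ))).fun_sub ((((1 - X ^ 2) ^ (m + 1) * derivative q).hasDerivAt z).ofReal_comp.fun_mul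
      (hasDerivAt_legendreSol hlam m hz))
  refine HasDerivAt.congr_deriv (f := lagrangeConcomitant lam m q) h ?_
  rw [hq]
  have h1 := legendreSol_ode hlam m hz
  simp only [eval_mul, eval_pow, eval_sub, eval_one, eval_X, eval_neg, eval_C]
  push_cast
  linear_combination (1 / 4) * (1 - (z : ℂ) ^ 2) ^ m * ((q.eval z : ℝ) : ℂ) * h1

theorem lagrangeConcomitant_one (lam : ℂ) (m : ℕ) (q : ℝ[X]) :
    lagrangeConcomitant lam m q 1 = 0 := by
  simp [lagrangeConcomitant]

theorem continuousOn_legendreSol {lam : ℂ} (hlam : ∀ n : ℤ, lam ≠ (n : ℂ)) (m : ℕ) :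
    ContinuousOn (legendreSol lam m) (Set.Ioc (-1) 1) := fun _ hz =>
  (hasDerivAt_legendreSol hlam m hz).continuousAt.continuousWithinAt

theorem mul_integral_legendreSol {lam : ℂ} (hlam : ∀ n : ℤ, lam ≠ (n : ℂ)) (m : ℕ)
    {q : ℝ[X]} {c : ℝ} (hq : derivative ((1 - X ^ 2) ^ (m + 1) * derivative q) =
      -(C (c - m * (m + 1)) * ((1 - X ^ 2) ^ m * q))) {z : ℝ} (hz : z ∈ Set.Ioc (-1 : ℝ) 1) :
    (c - lam * (lam + 1)) * ∫ y in z..1, ((((1 - X ^ 2) ^ m * q).eval y : ℝ) : ℂ) *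
      legendreSol lam m y = -lagrangeConcomitant lam m q z := by
  have hI : Set.uIcc z 1 ⊆ Set.Ioc (-1) 1 := by
    rw [Set.uIcc_of_le hz.2]
    exact fun y hy => ⟨hz.1.trans_le hy.1, hy.2⟩
  rw [← intervalIntegral.integral_const_mul, intervalIntegral.integral_eq_sub_of_hasDerivAt
    (fun y hy => hasDerivAt_lagrangeConcomitant hlam m hq (hI hy)), lagrangeConcomitant_one, zero_sub]
  exact (Polynomial.intervalIntegrable_eval_mul
    ((continuousOn_legendreSol hlam m).mono hI) _).const_mul _

theorem derivative_weight_mul_derivative_comp_neg {m : ℕ} {q : ℝ[X]} {c : ℝ}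
    (hq : derivative ((1 - X ^ 2) ^ (m + 1) * derivative q) =
      -(C (c - m * (m + 1)) * ((1 - X ^ 2) ^ m * q))) :
    derivative ((1 - X ^ 2) ^ (m + 1) * derivative (q.comp (-X))) =
      -(C (c - m * (m + 1)) * ((1 - X ^ 2) ^ m * q.comp (-X))) := by
  have h1 : (1 - X ^ 2 : ℝ[X]) ^ (m + 1) * derivative (q.comp (-X)) =
      -((1 - X ^ 2) ^ (m + 1) * derivative q).comp (-X) := by
    simp [derivative_comp]
  rw [h1, derivative_neg, derivative_comp, hq]
  simp

theorem mul_integral_legendreSol_neg {lam : ℂ} (hlam : ∀ n : ℤ, lam ≠ (n : ℂ)) (m : ℕ)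
    {q : ℝ[X]} {c : ℝ} (hq : derivative ((1 - X ^ 2) ^ (m + 1) * derivative q) =
      -(C (c - m * (m + 1)) * ((1 - X ^ 2) ^ m * q))) {z : ℝ} (hz : z ∈ Set.Ico (-1 : ℝ) 1) :
    (c - lam * (lam + 1)) * ∫ y in (-1 : ℝ)..z, ((((1 - X ^ 2) ^ m * q).eval y : ℝ) : ℂ) *
      legendreSol lam m (-y) = -lagrangeConcomitant lam m (q.comp (-X)) (-z) := by
  rw [← mul_integral_legendreSol hlam m (derivative_weight_mul_derivative_comp_neg hq)
    ⟨by linarith [hz.2], by linarith [hz.1]⟩]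
  congr 1
  have h := intervalIntegral.integral_comp_neg (a := -1) (b := z)
    fun y => ((((1 - X ^ 2) ^ m * q.comp (-X)).eval y : ℝ) : ℂ) * legendreSol lam m y
  rw [neg_neg] at h
  rw [← h]
  simp

/-- The Green's function of the `m` times differentiated Legendre operator, without the factor
that normalizes its Wronskian. -/
noncomputable def legendreGreen (lam : ℂ) (m : ℕ) (z₁ z : ℝ) : ℂ :=
  if z ≤ z₁ then legendreSol lam m z₁ * legendreSol lam m (-z)
  else legendreSol lam m (-z₁) * legendreSol lam m z

theorem legendreGreen_of_le {lam : ℂ} {m : ℕ} {z₁ z : ℝ} (h : z ≤ z₁) :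
    legendreGreen lam m z₁ z = legendreSol lam m z₁ * legendreSol lam m (-z) := if_pos h

theorem legendreGreen_of_ge {lam : ℂ} {m : ℕ} {z₁ z : ℝ} (h : z₁ ≤ z) :
    legendreGreen lam m z₁ z = legendreSol lam m (-z₁) * legendreSol lam m z := by
  rcases h.lt_or_eq with h | rfl
  · exact if_neg h.not_ge
  · rw [legendreGreen_of_le le_rfl, mul_comm]

theorem continuousOn_legendreGreen {lam : ℂ} (hlam : ∀ n : ℤ, lam ≠ (n : ℂ)) (m : ℕ) {z₁ : ℝ}
    (hz : z₁ ∈ Set.Ioo (-1 : ℝ) 1) :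
    ContinuousOn (legendreGreen lam m z₁) (Set.Icc (-1) 1) := by
  rw [← Set.Icc_union_Icc_eq_Icc hz.1.le hz.2.le]
  refine ContinuousOn.union_of_isClosed ?_ ?_ isClosed_Icc isClosed_Icc
  · refine ContinuousOn.congr (f := fun z => legendreSol lam m z₁ * legendreSol lam m (-z)) ?_
      fun z h => legendreGreen_of_le h.2
    refine continuousOn_const.mul ((continuousOn_legendreSol hlam m).comp continuousOn_neg ?_)
    exact fun z h => ⟨by linarith [h.2, hz.2], by linarith [h.1]⟩
  · refine ContinuousOn.congr (f := fun z => legendreSol lam m (-z₁) * legendreSol lam m z) ?_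
      fun z h => legendreGreen_of_ge h.1
    refine continuousOn_const.mul ((continuousOn_legendreSol hlam m).mono ?_)
    exact fun z h => ⟨hz.1.trans_le h.1, h.2⟩

theorem mul_integral_legendreGreen {lam : ℂ} (hlam : ∀ n : ℤ, lam ≠ (n : ℂ)) (m : ℕ)
    {q : ℝ[X]} {c : ℝ} (hq : derivative ((1 - X ^ 2) ^ (m + 1) * derivative q) =
      -(C (c - m * (m + 1)) * ((1 - X ^ 2) ^ m * q))) {z : ℝ} (hz : z ∈ Set.Ioo (-1 : ℝ) 1) :
    (c - lam * (lam + 1)) * ∫ y in (-1 : ℝ)..1, ((((1 - X ^ 2) ^ m * q).eval y : ℝ) : ℂ) *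
      legendreGreen lam m z y =
    2 * 4 ^ m * (pochProd lam m * (Complex.Gamma (-lam) * Complex.Gamma (1 + lam))⁻¹) *
      ((q.eval z : ℝ) : ℂ) := by
  have hg := continuousOn_legendreGreen hlam m hz
  rw [← intervalIntegral.integral_add_adjacent_intervals (b := z)
    (Polynomial.intervalIntegrable_eval_mul (hg.mono ?_) _)
    (Polynomial.intervalIntegrable_eval_mul (hg.mono ?_) _)]
  rotate_left
  · rw [Set.uIcc_of_le hz.1.le]
    exact Set.Icc_subset_Icc_right hz.2.le
  · rw [Set.uIcc_of_le hz.2.le]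
    exact Set.Icc_subset_Icc_left hz.1.le
  have h1 : ∫ y in (-1 : ℝ)..z, ((((1 - X ^ 2) ^ m * q).eval y : ℝ) : ℂ) * legendreGreen lam m z y =
      legendreSol lam m z * ∫ y in (-1 : ℝ)..z,
        ((((1 - X ^ 2) ^ m * q).eval y : ℝ) : ℂ) * legendreSol lam m (-y) := by
    rw [← intervalIntegral.integral_const_mul]
    refine intervalIntegral.integral_congr fun y hy => ?_
    rw [Set.uIcc_of_le hz.1.le] at hy
    simp only [legendreGreen_of_le hy.2]
    ring
  have h2 : ∫ y in z..1, ((((1 - X ^ 2) ^ m * q).eval y : ℝ) : ℂ) * legendreGreen lam m z y =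
      legendreSol lam m (-z) * ∫ y in z..1,
        ((((1 - X ^ 2) ^ m * q).eval y : ℝ) : ℂ) * legendreSol lam m y := by
    rw [← intervalIntegral.integral_const_mul]
    refine intervalIntegral.integral_congr fun y hy => ?_
    rw [Set.uIcc_of_le hz.2.le] at hy
    simp only [legendreGreen_of_ge hy.1]
    ring
  have h3 := mul_integral_legendreSol hlam m hq (z := z) ⟨hz.1, hz.2.le⟩
  have h4 := mul_integral_legendreSol_neg hlam m hq (z := z) ⟨hz.1.le, hz.2⟩
  have hx : (1 : ℂ) - (((1 - z) / 2 : ℝ) : ℂ) = (((1 - -z) / 2 : ℝ) : ℂ) := by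
    push_cast
    ring
  have h5 := hypWronskian_eq hlam m (x := (((1 - z) / 2 : ℝ) : ℂ))
    (norm_one_sub_div_two_lt_one ⟨hz.1, hz.2.le⟩)
    (by
      rw [hx]
      exact norm_one_sub_div_two_lt_one ⟨by linarith [hz.2], by linarith [hz.1]⟩)
  rw [hypWronskian, hx] at h5
  simp only [hypDeriv_one_sub_div_two] at h5
  have h6 : 4 ^ (m + 1) * ((((1 - z) / 2 : ℝ) : ℂ) * (((1 - -z) / 2 : ℝ) : ℂ)) ^ (m + 1) =
      (1 - (z : ℂ) ^ 2) ^ (m + 1) := by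
    rw [← mul_pow]
    congr 1
    push_cast
    ring
  rw [h1, h2, mul_add, mul_left_comm, h4, mul_left_comm, h3, ← h5]
  simp only [lagrangeConcomitant, derivative_comp, eval_mul, eval_pow, eval_sub, eval_one, eval_X,
    eval_comp, eval_neg, derivative_neg, derivative_X, neg_neg]
  push_cast
  rw [neg_sq, ← h6]
  push_cast
  ring

end GreenFunction

section Expansion

open Filter Topology Polynomial

theorem natCast_mul_succ_sub_ne_zero {lam : ℂ} (hlam : ∀ n : ℤ, lam ≠ (n : ℂ)) (l : ℕ) :
    (l : ℂ) * (l + 1) - lam * (lam + 1) ≠ 0 := by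
  have h : (l : ℂ) * (l + 1) - lam * (lam + 1) = (l - lam) * (l + 1 + lam) := by ring
  rw [h]
  refine mul_ne_zero (fun h0 => ?_) fun h0 => ?_
  · exact hlam l (by push_cast; linear_combination -h0)
  · exact hlam (-(l + 1)) (by push_cast; linear_combination h0)

theorem summable_inv_norm_natCast_mul_succ_sub {lam : ℂ} :
    Summable fun l : ℕ => ‖(l : ℂ) * (l + 1) - lam * (lam + 1)‖⁻¹ := by
  have h := ((tendsto_natCast_add_div_natCast_add 0 (-lam)).mul
    (tendsto_natCast_add_div_natCast_add 0 (1 + lam))).norm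
  rw [mul_one, norm_one] at h
  refine Summable.of_norm_bounded_eventually_nat
    ((Real.summable_nat_pow_inv (p := 2)).mpr one_lt_two |>.mul_left 2) ?_
  filter_upwards [h.eventually_le_const one_lt_two, eventually_ne_atTop 0] with n hn hn0
  have e : (n : ℂ) * (n + 1) - lam * (lam + 1) = (n + -lam) * (n + (1 + lam)) := by ring
  rw [norm_inv, norm_norm, e]
  rw [add_zero, div_mul_div_comm, norm_div, norm_mul (n : ℂ), Complex.norm_natCast,
    div_eq_mul_inv] at hn
  have hpos : (0 : ℝ) < n ^ 2 := by positivity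
  rw [← div_eq_mul_inv, le_div_iff₀ hpos]
  linarith

theorem weight_mul_abs_legendreDeriv_mul_le (m k : ℕ) {z₁ z : ℝ}
    (hz₁ : z₁ ∈ Set.Ioo (-1 : ℝ) 1) (hz : z ∈ Set.Icc (-1 : ℝ) 1) :
    (1 - z ^ 2) ^ (2 * m + 1) *
        |(legendreDeriv (m + k) m).eval z * (legendreDeriv (m + k) m).eval z₁| ≤
      (polyIntegral ((1 - X ^ 2) ^ m))⁻¹ * (1 + ((1 - z₁ ^ 2) ^ (2 * m + 1))⁻¹) *
        legendreDerivNormSq m k := by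
  have hI := polyIntegral_weight_pos m
  have h1 := legendreDeriv_sq_le m k hz
  have h2 := legendreDeriv_sq_le m k (Set.Ioo_subset_Icc_self hz₁)
  rw [← legendreDerivNormSq] at h1 h2
  have hs : 0 < (1 - z₁ ^ 2) ^ (2 * m + 1) := by
    have : 0 < 1 - z₁ ^ 2 := by nlinarith [hz₁.1, hz₁.2]
    positivity
  have ht0 : 0 ≤ (1 - z ^ 2) ^ (2 * m + 1) := pow_nonneg (one_sub_sq_nonneg hz) _
  have ht1 : (1 - z ^ 2) ^ (2 * m + 1) ≤ 1 :=
    pow_le_one₀ (one_sub_sq_nonneg hz) (by nlinarith [sq_nonneg z])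
  generalize (1 - z ^ 2) ^ (2 * m + 1) = t at *
  generalize (1 - z₁ ^ 2) ^ (2 * m + 1) = s at *
  generalize (legendreDeriv (m + k) m).eval z = a at *
  generalize (legendreDeriv (m + k) m).eval z₁ = b at *
  generalize polyIntegral ((1 - X ^ 2) ^ m) = I at *
  have h3 : t * a ^ 2 ≤ I⁻¹ * (2 * legendreDerivNormSq m k) := by
    rw [inv_mul_eq_div, le_div_iff₀ hI]
    linarith
  have h4 : b ^ 2 ≤ I⁻¹ * s⁻¹ * (2 * legendreDerivNormSq m k) := by
    rw [← mul_inv, inv_mul_eq_div, le_div_iff₀ (mul_pos hI hs)]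
    linarith
  have h5 : 2 * |a * b| ≤ a ^ 2 + b ^ 2 := by
    rw [abs_mul]
    nlinarith [sq_nonneg (|a| - |b|), sq_abs a, sq_abs b]
  have h6 : t * b ^ 2 ≤ b ^ 2 := mul_le_of_le_one_left (sq_nonneg b) ht1
  have h7 := mul_le_mul_of_nonneg_left h5 ht0
  linarith

theorem hasSum_legendreGreen {lam : ℂ} (hlam : ∀ n : ℤ, lam ≠ (n : ℂ)) (m : ℕ) {z₁ z : ℝ}
    (hz₁ : z₁ ∈ Set.Ioo (-1 : ℝ) 1) (hz : z ∈ Set.Ioo (-1 : ℝ) 1) :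
    HasSum (fun k : ℕ => 2 * 4 ^ m *
        (pochProd lam m * (Complex.Gamma (-lam) * Complex.Gamma (1 + lam))⁻¹) *
        (((legendreDeriv (m + k) m).eval z₁ * (legendreDeriv (m + k) m).eval z /
          legendreDerivNormSq m k : ℝ) : ℂ) /
        (((m + k : ℕ) : ℂ) * (((m + k : ℕ) : ℂ) + 1) - lam * (lam + 1)))
      (legendreGreen lam m z₁ z) := by
  set K := 2 * 4 ^ m * (pochProd lam m * (Complex.Gamma (-lam) * Complex.Gamma (1 + lam))⁻¹)
  have hcoeff : ∀ k, legendreDerivCoeff m (legendreGreen lam m z₁) k =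
      K * (((legendreDeriv (m + k) m).eval z₁ : ℝ) : ℂ) /
        (((m + k : ℕ) : ℂ) * (((m + k : ℕ) : ℂ) + 1) - lam * (lam + 1)) := fun k => by
    have h := mul_integral_legendreGreen hlam m (q := legendreDeriv (m + k) m)
      (by rw [derivative_legendreDeriv]; exact derivative_weight_mul_legendreDeriv (m + k) m) hz₁
    rw [eq_div_iff (natCast_mul_succ_sub_ne_zero hlam _), mul_comm, ← h]
    push_cast
    rfl
  set A : ℝ := (polyIntegral ((1 - X ^ 2) ^ m))⁻¹ * (1 + ((1 - z₁ ^ 2) ^ (2 * m + 1))⁻¹)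
  have hsum : Summable fun k : ℕ => ‖K‖ * A *
      ‖((m + k : ℕ) : ℂ) * (((m + k : ℕ) : ℂ) + 1) - lam * (lam + 1)‖⁻¹ :=
    ((summable_inv_norm_natCast_mul_succ_sub (lam := lam)).comp_injective
      (add_right_injective m)).mul_left _
  have h := hasSum_legendreDeriv_expansion m (continuousOn_legendreGreen hlam m hz₁) hsum
    (fun k y hy => ?_) hz
  · refine h.of_forall_eq fun k => ?_
    rw [hcoeff]
    push_cast
    ring
  · have hN := legendreDerivNormSq_pos m k
    have hb := weight_mul_abs_legendreDeriv_mul_le m k hz₁ hy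
    rw [← div_le_iff₀ hN] at hb
    have ht0 : 0 ≤ (1 - y ^ 2) ^ (2 * m + 1) := pow_nonneg (one_sub_sq_nonneg hy) _
    rw [hcoeff, norm_mul, norm_div, norm_div, norm_mul, Complex.norm_real, Complex.norm_real,
      Complex.norm_real, norm_mul, Real.norm_of_nonneg ht0, Real.norm_of_nonneg hN.le,
      Real.norm_eq_abs, Real.norm_eq_abs]
    calc _ = ‖K‖ * ((1 - y ^ 2) ^ (2 * m + 1) *
          |(legendreDeriv (m + k) m).eval y * (legendreDeriv (m + k) m).eval z₁| /
          legendreDerivNormSq m k) *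
          ‖((m + k : ℕ) : ℂ) * (((m + k : ℕ) : ℂ) + 1) - lam * (lam + 1)‖⁻¹ := by
            rw [abs_mul]
            ring
      _ ≤ _ := by gcongr

theorem two_pi_mul_LnormNat_mul_LnormNat (m k : ℕ) (z₁ z₂ : ℝ) :
    2 * Real.pi * (LnormNat (m + k) m z₁ * LnormNat (m + k) m z₂) =
      (1 - z₁ ^ 2) ^ ((m : ℝ) / 2) * (1 - z₂ ^ 2) ^ ((m : ℝ) / 2) *
        ((legendreDeriv (m + k) m).eval z₁ * (legendreDeriv (m + k) m).eval z₂ /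
          legendreDerivNormSq m k) := by
  have hs : (-1 : ℝ) ^ m * (-1) ^ m = 1 := by rw [← mul_pow]; simp
  have hN : legendreDerivNormSq m k = _ := polyIntegral_legendreDeriv_sq k m
  rw [LnormNat, LnormNat, assocLegendreNat, assocLegendreNat, iteratedDeriv_legendreP,
    iteratedDeriv_legendreP, mul_mul_mul_comm (√_) _ (√_), Real.mul_self_sqrt (by positivity), hN,
    Nat.add_sub_cancel_left, show m + k + m = 2 * m + k by ring]
  have hf : ((2 * m + k).factorial : ℝ) ≠ 0 := by exact_mod_cast Nat.factorial_ne_zero _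
  have hf' : (k.factorial : ℝ) ≠ 0 := by exact_mod_cast Nat.factorial_ne_zero _
  have hl : 2 * ((m + k : ℕ) : ℝ) + 1 ≠ 0 := by positivity
  have hpi := Real.pi_ne_zero
  generalize (1 - z₁ ^ 2) ^ ((m : ℝ) / 2) = a
  generalize (1 - z₂ ^ 2) ^ ((m : ℝ) / 2) = b
  generalize (-1 : ℝ) ^ m = e at *
  field_simp
  linear_combination 4 * a * b * (legendreDeriv (m + k) m).eval z₁ *
    (legendreDeriv (m + k) m).eval z₂ * hs

theorem ascPochhammer_eval_one_add_natCast (m n : ℕ) :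
    (ascPochhammer ℂ n).eval (1 + (m : ℂ)) = ((m + n).factorial : ℂ) / (m.factorial : ℂ) := by
  have hm : (m.factorial : ℂ) ≠ 0 := by exact_mod_cast m.factorial_ne_zero
  rw [eq_div_iff hm]
  induction n with
  | zero => simp
  | succ n ih =>
    rw [ascPochhammer_succ_eval, ← add_assoc, Nat.factorial_succ, Nat.cast_mul, ← ih]
    push_cast
    ring

theorem hyp2F1_eq_factorial_mul_scaledHyp (lam : ℂ) (m : ℕ) (x : ℂ) :
    hyp2F1 (-lam) (lam + 1) (1 + (m : ℂ)) x = (m.factorial : ℂ) * scaledHyp lam m x := by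
  rw [hyp2F1, scaledHyp, ← tsum_mul_left]
  refine tsum_congr fun n => ?_
  have hm : (m.factorial : ℂ) ≠ 0 := by exact_mod_cast m.factorial_ne_zero
  have hmn : ((m + n).factorial : ℂ) ≠ 0 := by exact_mod_cast (m + n).factorial_ne_zero
  have hn : (n.factorial : ℂ) ≠ 0 := by exact_mod_cast n.factorial_ne_zero
  rw [ascPochhammer_eval_one_add_natCast, legendreCoeff, add_comm lam 1]
  field_simp

theorem PLeg_eq_legendreSol (m : ℕ) (lam : ℂ) {z : ℝ} (hz : z ∈ Set.Ioo (-1 : ℝ) 1) :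
    PLeg m lam z =
      (((1 - z ^ 2) ^ ((m : ℝ) / 2) : ℝ) : ℂ) / 2 ^ m * legendreSol lam m z := by
  have h1 : 0 < 1 - z := by linarith [hz.2]
  have h2 : 0 < 1 + z := by linarith [hz.1]
  have h3 : (1 - z ^ 2) ^ ((m : ℝ) / 2) = ((1 - z) / (1 + z)) ^ ((m : ℝ) / 2) * (1 + z) ^ m := by
    rw [show 1 - z ^ 2 = (1 - z) / (1 + z) * (1 + z) ^ 2 by field_simp; ring,
      Real.mul_rpow (by positivity) (by positivity), ← Real.rpow_natCast_mul h2.le]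
    congr 1
    rw [← Real.rpow_natCast]
    congr 1
    push_cast
    ring
  have h4 : ((1 - z) / (1 + z) : ℂ) ^ ((m : ℂ) / 2) =
      ((((1 - z) / (1 + z)) ^ ((m : ℝ) / 2) : ℝ) : ℂ) := by
    rw [Complex.ofReal_cpow (by positivity)]
    push_cast
    rfl
  have h5 : (1 : ℂ) - (((1 - z) / 2 : ℝ) : ℂ) = (1 + z) / 2 := by
    push_cast
    ring
  have hm : (m.factorial : ℂ) ≠ 0 := by exact_mod_cast m.factorial_ne_zero
  have hz' : (1 + z : ℂ) ≠ 0 := by exact_mod_cast h2.ne'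
  rw [PLeg, hyp2F1_eq_factorial_mul_scaledHyp, h4, h3, legendreSol, hypDeriv, pochProd, h5,
    div_pow]
  push_cast
  field_simp

theorem Gamma_mul_Gamma_mul_pochProd {lam : ℂ} (hlam : ∀ n : ℤ, lam ≠ (n : ℂ)) (m : ℕ) :
    Complex.Gamma (1 + lam - m) * Complex.Gamma (-lam - m) * pochProd lam m =
      Complex.Gamma (-lam) * Complex.Gamma (1 + lam) := by
  induction m with
  | zero => simp [pochProd, mul_comm]
  | succ m ih =>
    have h1 : lam - m ≠ 0 := fun h => hlam m (by push_cast; linear_combination h)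
    have h2 : -lam - (m + 1) ≠ 0 := fun h =>
      hlam (-(m + 1)) (by push_cast; linear_combination -h)
    have h3 := Complex.Gamma_add_one _ h1
    have h4 := Complex.Gamma_add_one _ h2
    rw [show lam - m + 1 = 1 + lam - m by ring] at h3
    rw [show -lam - (m + 1) + 1 = -lam - m by ring] at h4
    rw [← ih, pochProd_succ, h3, h4, Nat.cast_succ, show 1 + lam - (m + 1) = lam - m by ring]
    ring

end Expansion

theorem bilinear_expansion_of_green_function (m : ℕ) (lam : ℂ)
    (hlam : ∀ n : ℤ, lam ≠ (n : ℂ)) (z₁ z₂ : ℝ)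
    (hz₁ : z₁ ∈ Set.Ioo (-1 : ℝ) 1) (hz₂ : z₂ ∈ Set.Ioo (-1 : ℝ) 1) (h12 : z₁ ≤ z₂) :
    Summable (fun l : ℕ => if m ≤ l then
      ((LnormNat l m z₁ * LnormNat l m z₂ : ℝ) : ℂ) /
        ((l : ℂ) * ((l : ℂ) + 1) - lam * (lam + 1)) else 0) ∧
    (2 * (Real.pi : ℂ)) * ∑' l : ℕ, (if m ≤ l then
        ((LnormNat l m z₁ * LnormNat l m z₂ : ℝ) : ℂ) /
          ((l : ℂ) * ((l : ℂ) + 1) - lam * (lam + 1)) else 0)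
      = (1 / 2 : ℂ) * Complex.Gamma (1 + lam - m) * Complex.Gamma (-lam - m) *
          PLeg m lam (-z₁) * PLeg m lam z₂ := by
  have hpi : (2 * (Real.pi : ℂ)) ≠ 0 := by
    exact_mod_cast (mul_pos two_pos Real.pi_pos).ne'
  have hG := Gamma_mul_Gamma_mul_pochProd hlam m
  have hp := pochProd_ne_zero hlam m
  have hG0 : Complex.Gamma (-lam) * Complex.Gamma (1 + lam) ≠ 0 :=
    mul_ne_zero
      (Complex.Gamma_ne_zero fun k h => hlam k (by push_cast; linear_combination -h))
      (Complex.Gamma_ne_zero fun k h => hlam (-(k + 1)) (by push_cast; linear_combination h))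
  set K := 2 * 4 ^ m *
    (pochProd lam m * (Complex.Gamma (-lam) * Complex.Gamma (1 + lam))⁻¹) with hK
  have hK0 : K ≠ 0 := mul_ne_zero (mul_ne_zero two_ne_zero (pow_ne_zero _ (by norm_num)))
    (mul_ne_zero hp (inv_ne_zero hG0))
  have h := (hasSum_legendreGreen hlam m hz₁ hz₂).mul_left
    ((((1 - z₁ ^ 2) ^ ((m : ℝ) / 2) * (1 - z₂ ^ 2) ^ ((m : ℝ) / 2) : ℝ) : ℂ) *
      K⁻¹)
  simp only [← hK] at h
  have hsum : HasSum (fun l : ℕ => 2 * (Real.pi : ℂ) * (if m ≤ l then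
      ((LnormNat l m z₁ * LnormNat l m z₂ : ℝ) : ℂ) /
        ((l : ℂ) * ((l : ℂ) + 1) - lam * (lam + 1)) else 0))
      ((((1 - z₁ ^ 2) ^ ((m : ℝ) / 2) * (1 - z₂ ^ 2) ^ ((m : ℝ) / 2) : ℝ) : ℂ) *
        K⁻¹ * legendreGreen lam m z₁ z₂) := by
    refine ((add_right_injective m).hasSum_iff fun l hl => ?_).mp (h.of_forall_eq fun k => ?_)
    · rw [if_neg, mul_zero]
      exact fun hml => hl ⟨l - m, Nat.add_sub_cancel' hml⟩
    · have hL := congrArg Complex.ofReal (two_pi_mul_LnormNat_mul_LnormNat m k z₁ z₂)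
      simp only [Function.comp, if_pos (Nat.le_add_right m k)]
      rw [Complex.ofReal_mul (2 * Real.pi), Complex.ofReal_mul 2, Complex.ofReal_ofNat] at hL
      rw [mul_div_assoc', hL, Complex.ofReal_mul]
      field_simp
  have hsum' := hsum.mul_left (2 * (Real.pi : ℂ))⁻¹
  simp only [inv_mul_cancel_left₀ hpi] at hsum'
  refine ⟨hsum'.summable, ?_⟩
  rw [hsum'.tsum_eq, mul_inv_cancel_left₀ hpi, legendreGreen_of_ge h12, hK, ← hG,
    PLeg_eq_legendreSol m lam (z := -z₁) ⟨by linarith [hz₁.2], by linarith [hz₁.1]⟩,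
    PLeg_eq_legendreSol m lam hz₂, neg_sq, show (4 : ℂ) = 2 * 2 by norm_num, mul_pow]
  rw [← hG] at hG0
  have hG1 := left_ne_zero_of_mul (left_ne_zero_of_mul hG0)
  have hG2 := right_ne_zero_of_mul (left_ne_zero_of_mul hG0)
  push_cast
  field_simp
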